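/- arXiv:1406.0427 — 4 statements merged into one kernel-verified Lean document; each statement's English description precedes it below -/
import Mathlib

section
/- Let f : ℝ → [0,∞) be a non-decreasing function such that the Laplace transform F(s) = ∫₀^∞ f(u) e^{-su} du converges absolutely for Re(s) > 1. Let α, α₁, …, α_r be positive real numbers with α > α_i for all i, let A > 0 be a real number and A₁, …, A_r be complex numbers. Define G(s) = F(s) − A/(s−1)^α − Σ_{i=1}^r A_i/(s−1)^{α_i} for Re(s) > 1, where (s−1)^β denotes the principal branch exp(β log(s−1)). Suppose that G extends continuously to the closed half-plane {s ∈ ℂ : Re(s) ≥ 1}, and, if α < 1, assume in addition that the extended function t ↦ G(1 + it) is of bounded variation on every compact interval of ℝ. Then lim_{u → ∞} u^{1−α} e^{-u} f(u) = A/Γ(α). -/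
open MeasureTheory Set Filter Complex Topology

theorem integrableOn_rpow_mul_exp_neg_mul {β r : ℝ} (hβ : 0 < β) (hr : 0 < r) :
    IntegrableOn (fun u : ℝ => u ^ (β - 1) * Real.exp (-(r * u))) (Ioi 0) := by
  have := integrableOn_rpow_mul_exp_neg_mul_rpow (p := 1) (s := β - 1) (b := r)
    (by linarith) one_pos hr
  simpa using this

/-- The Laplace transform of `u ^ (β - 1)` on the right half-plane. -/
theorem integral_rpow_mul_cexp_neg_mul {β : ℝ} (hβ : 0 < β) {z : ℂ} (hz : 0 < z.re) :
    ∫ u in Ioi (0 : ℝ), ((u ^ (β - 1) : ℝ) : ℂ) * Complex.exp (-z * u)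
      = Real.Gamma β / z ^ (β : ℂ) := by
  set μ : Measure ℝ := (volume.restrict (Ioi 0)).withDensity
    (fun u => ENNReal.ofReal (u ^ (β - 1))) with hμ
  have hmeas : Measurable (fun u : ℝ => Real.toNNReal (u ^ (β - 1))) := by fun_prop
  have hset : Ioi (0 : ℝ) ⊆ ProbabilityTheory.integrableExpSet (fun u : ℝ => -u) μ := by
    intro r hr
    have : Integrable (fun u : ℝ => Real.exp (r * -u)) μ := by
      rw [hμ]
      have h := integrable_withDensity_iff_integrable_smul (μ := volume.restrict (Ioi (0 : ℝ)))
        hmeas (g := fun u : ℝ => Real.exp (r * -u))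
      refine h.mpr ?_
      refine (integrableOn_rpow_mul_exp_neg_mul hβ hr).congr_fun (fun u hu => ?_)
        measurableSet_Ioi
      have : 0 ≤ u ^ (β - 1) := Real.rpow_nonneg (le_of_lt hu) _
      simp [NNReal.smul_def, Real.coe_toNNReal _ this]
    exact this
  have heq : ∀ w : ℂ, ProbabilityTheory.complexMGF (fun u : ℝ => -u) μ w
      = ∫ u in Ioi (0 : ℝ), ((u ^ (β - 1) : ℝ) : ℂ) * Complex.exp (-w * u) := by
    intro w
    rw [ProbabilityTheory.complexMGF, hμ]
    have h := integral_withDensity_eq_integral_smul (μ := volume.restrict (Ioi (0 : ℝ)))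
        hmeas (fun u : ℝ => cexp (w * ((-u : ℝ) : ℂ)))
    refine h.trans (setIntegral_congr_fun measurableSet_Ioi fun u hu => ?_)
    have : 0 ≤ u ^ (β - 1) := Real.rpow_nonneg (le_of_lt hu) _
    simp [NNReal.smul_def, Real.coe_toNNReal _ this]
  have hopen : IsOpen {w : ℂ | 0 < w.re} := isOpen_lt continuous_const Complex.continuous_re
  have hA : AnalyticOnNhd ℂ (ProbabilityTheory.complexMGF (fun u : ℝ => -u) μ)
      {w : ℂ | 0 < w.re} := ProbabilityTheory.analyticOnNhd_complexMGF.mono fun w hw =>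
    interior_mono hset (by rw [interior_Ioi]; exact hw)
  have hB : AnalyticOnNhd ℂ (fun w : ℂ => Real.Gamma β / w ^ (β : ℂ)) {w : ℂ | 0 < w.re} := by
    apply DifferentiableOn.analyticOnNhd _ hopen
    intro w hw
    have hw' : w ∈ slitPlane := Or.inl hw
    have hw0 : w ≠ 0 := slitPlane_ne_zero hw'
    refine DifferentiableAt.differentiableWithinAt ?_
    refine (differentiableAt_const _).div (differentiableAt_id.cpow_const hw') ?_
    simp [cpow_eq_zero_iff, hw0]
  have hpre : IsPreconnected {w : ℂ | 0 < w.re} :=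
    (convex_halfSpace_re_gt 0).isPreconnected
  have hfreq : ∃ᶠ w in 𝓝[≠] (1 : ℂ), ProbabilityTheory.complexMGF (fun u : ℝ => -u) μ w
      = Real.Gamma β / w ^ (β : ℂ) := by
    have hreal : ∀ r : ℝ, 0 < r → ProbabilityTheory.complexMGF (fun u : ℝ => -u) μ r
      = Real.Gamma β / (r : ℂ) ^ (β : ℂ) := by
      intro r hr
      rw [heq]
      have h := Real.integral_rpow_mul_exp_neg_mul_Ioi hβ hr
      have h2 : ∫ u in Ioi (0 : ℝ), ((u ^ (β - 1) : ℝ) : ℂ) * Complex.exp (-r * u)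
        = ((∫ u in Ioi (0 : ℝ), u ^ (β - 1) * Real.exp (-(r * u)) : ℝ) : ℂ) := by
        rw [← integral_complex_ofReal]
        simp
      rw [h2, h, ← ofReal_cpow hr.le, Real.div_rpow zero_le_one hr.le, Real.one_rpow]
      push_cast
      ring
    have ht : Tendsto (fun r : ℝ => (r : ℂ)) (𝓝[≠] 1) (𝓝[≠] 1) := by
      apply tendsto_nhdsWithin_of_tendsto_nhds_of_eventually_within
      · exact (Complex.continuous_ofReal.tendsto' 1 1 (by simp)).mono_left nhdsWithin_le_nhds
      · filter_upwards [self_mem_nhdsWithin] with r hr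
        simpa using hr
    refine ht.frequently (Eventually.frequently ?_)
    filter_upwards [nhdsWithin_le_nhds (lt_mem_nhds (zero_lt_one' ℝ))] with r hr
    exact hreal r hr
  rw [← heq]
  exact hA.eqOn_of_preconnected_of_frequently_eq hB hpre (by simp) hfreq hz

/-- A nonnegative, rapidly decreasing kernel `K` of integral one on the line which is the Fourier
transform of a compactly supported Lipschitz function `φ`. -/
structure IsBandLimitedKernel (K : ℝ → ℝ) (φ : ℝ → ℂ) : Prop where
  nonneg : ∀ x, 0 ≤ K x
  continuous : Continuous K
  decay : ∀ n : ℕ, ∃ C, ∀ x, (1 + |x|) ^ n * |K x| ≤ C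
  integral_eq_one : ∫ x, K x = 1
  continuous_transform : Continuous φ
  compact_transform : HasCompactSupport φ
  lipschitz_transform : ∃ M, LipschitzWith M φ
  eq_integral : ∀ x, (K x : ℂ) = ∫ t : ℝ, φ t * Complex.exp (-(t * x * I))

theorem integrable_of_decay {K : ℝ → ℝ} (hK : AEStronglyMeasurable K)
    (hdec : ∀ n : ℕ, ∃ C, ∀ x, (1 + |x|) ^ n * |K x| ≤ C) (m : ℕ) :
    Integrable (fun x => (1 + |x|) ^ m * K x) := by
  obtain ⟨C, hC⟩ := hdec (m + 2)
  have h1 : Integrable (fun x : ℝ => C * (1 + ‖x‖) ^ (-(2 : ℝ))) :=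
    (integrable_one_add_norm (by simp)).const_mul C
  refine h1.mono' (by fun_prop) (ae_of_all _ fun x => ?_)
  have hpos : 0 < 1 + |x| := by positivity
  rw [Real.norm_eq_abs, Real.norm_eq_abs, abs_mul, abs_of_nonneg (by positivity),
    Real.rpow_neg hpos.le, ← div_eq_mul_inv, le_div_iff₀ (by positivity)]
  calc _ = (1 + |x|) ^ (m + 2) * |K x| := by norm_cast; ring
    _ ≤ C := hC x

namespace IsBandLimitedKernel

variable {K : ℝ → ℝ} {φ : ℝ → ℂ}

theorem integrable (h : IsBandLimitedKernel K φ) : Integrable K := by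
  simpa using integrable_of_decay h.continuous.aestronglyMeasurable h.decay 0

theorem scale (h : IsBandLimitedKernel K φ) {c : ℝ} (hc : 0 < c) :
    IsBandLimitedKernel (fun x => c * K (c * x)) (fun t => φ (t / c)) where
  nonneg x := mul_nonneg hc.le (h.nonneg _)
  continuous := by have := h.continuous; fun_prop
  decay n := by
    obtain ⟨C, hC⟩ := h.decay n
    refine ⟨c * ((max 1 c⁻¹) ^ n * C), fun x => ?_⟩
    have h1 : 1 + |x| ≤ max 1 c⁻¹ * (1 + |c * x|) := by
      have e : |x| = c⁻¹ * |c * x| := by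
        rw [abs_mul, abs_of_pos hc]; field_simp
      have h2 := le_max_left 1 c⁻¹
      have h3 := le_max_right 1 c⁻¹
      have h4 := abs_nonneg (c * x)
      rw [e]
      nlinarith [mul_le_mul_of_nonneg_right h3 h4]
    rw [abs_mul, abs_of_pos hc, mul_left_comm]
    refine mul_le_mul_of_nonneg_left ?_ hc.le
    calc (1 + |x|) ^ n * |K (c * x)| ≤ (max 1 c⁻¹ * (1 + |c * x|)) ^ n * |K (c * x)| := by gcongr
      _ = (max 1 c⁻¹) ^ n * ((1 + |c * x|) ^ n * |K (c * x)|) := by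
        rw [mul_pow, mul_assoc]
      _ ≤ _ := by gcongr; exact hC _
  integral_eq_one := by
    rw [integral_const_mul, Measure.integral_comp_mul_left, h.integral_eq_one,
      abs_of_pos (by positivity)]
    simp [hc.ne']
  continuous_transform := by have := h.continuous_transform; fun_prop
  compact_transform := by
    have := h.compact_transform.comp_homeomorph (Homeomorph.mulRight₀ c⁻¹ (by positivity))
    simpa [Function.comp_def, div_eq_mul_inv] using this
  lipschitz_transform := by
    obtain ⟨M, hM⟩ := h.lipschitz_transform
    refine ⟨M * ‖c⁻¹‖₊, ?_⟩
    have : LipschitzWith ‖c⁻¹‖₊ (fun t : ℝ => t / c) := by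
      simpa [div_eq_inv_mul] using lipschitzWith_smul (β := ℝ) c⁻¹
    exact hM.comp this
  eq_integral x := by
    have := Measure.integral_comp_div (fun t : ℝ => φ t * Complex.exp (-(t * (c * x : ℝ) * I))) c
    rw [← h.eq_integral, abs_of_pos hc] at this
    push_cast
    refine Eq.trans ?_ (this.symm.trans ?_)
    · simp
    · refine integral_congr_ae (ae_of_all _ fun t => ?_)
      have : (c : ℂ) ≠ 0 := by exact_mod_cast hc.ne'
      simp only [ofReal_div, ofReal_mul]
      congr 3
      field_simp

end IsBandLimitedKernel

open FourierTransform Convolution ContDiff in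
theorem exists_isBandLimitedKernel : ∃ K φ, IsBandLimitedKernel K φ := by
  let b : ContDiffBump (0 : ℝ) := ⟨1, 2, one_pos, one_lt_two⟩
  let ψ : ℝ → ℂ := fun t => (b t : ℂ)
  have hψc : ContDiff ℝ ∞ ψ := ofRealCLM.contDiff.comp b.contDiff
  have hψs : HasCompactSupport ψ := b.hasCompactSupport.comp_left (g := ofReal) rfl
  have hψi : Integrable ψ := hψc.continuous.integrable_of_hasCompactSupport hψs
  let χ : ℝ → ℂ := ψ ⋆[ContinuousLinearMap.mul ℂ ℂ] ψ
  have hχc : ContDiff ℝ ∞ χ := by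
    exact hψs.contDiff_convolution_right (ContinuousLinearMap.mul ℝ ℂ)
      (hψc.continuous.locallyIntegrable (μ := volume)) hψc
  have hχs : HasCompactSupport χ := hψs.convolution _ hψs
  let S := 𝓕 (hχs.toSchwartzMap hχc)
  have hS : ∀ x, S x = 𝓕 ψ x * 𝓕 ψ x := fun x =>
    Real.fourier_mul_convolution_eq hψi hψi x
  have hreal : ∀ x, 𝓕 ψ x = (((𝓕 ψ x).re : ℝ) : ℂ) := by
    intro x
    rw [eq_comm, ← conj_eq_iff_re, Real.fourier_real_eq, ← integral_conj, ← integral_neg_eq_self]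
    refine integral_congr_ae (ae_of_all _ fun t => ?_)
    have : b (-t) = b t := b.neg t
    simp [ψ, Circle.smul_def, Real.fourierChar_apply, ← Complex.exp_conj, this, Complex.conj_ofNat]
  let k : ℝ → ℝ := fun x => (𝓕 ψ x).re ^ 2
  have hk : ∀ x, (k x : ℂ) = S x := by
    intro x
    rw [hS, hreal]; simp [k, sq]
  have hk0 : 0 < k 0 := by
    have h0 : 𝓕 ψ 0 = ((∫ t, b t : ℝ) : ℂ) := by
      rw [Real.fourier_real_eq, ← integral_complex_ofReal]
      simp [ψ]
    have : 0 < ∫ t, b t := b.integral_pos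
    simp only [k, h0, ofReal_re]
    positivity
  have hkc : Continuous k := by
    have : k = fun x => (S x).re := by ext x; rw [← hk]; simp
    rw [this]; exact Complex.continuous_re.comp S.continuous
  have hkn : ∀ x, |k x| = ‖S x‖ := fun x => by rw [← hk]; simp
  have hkd : ∀ n : ℕ, ∃ C, ∀ x, (1 + |x|) ^ n * |k x| ≤ C := by
    intro n
    have h := SchwartzMap.one_add_le_sup_seminorm_apply (𝕜 := ℝ) (m := (n, 0)) le_rfl le_rfl S
    simp only [norm_iteratedFDeriv_zero, Real.norm_eq_abs] at h
    exact ⟨_, fun x => hkn x ▸ h x⟩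
  have hki : Integrable k := by
    simpa using integrable_of_decay hkc.aestronglyMeasurable hkd 0
  have hI : 0 < ∫ x, k x := by
    rw [integral_pos_iff_support_of_nonneg (fun x => sq_nonneg _) hki]
    exact hkc.isOpen_support.measure_pos _ ⟨0, hk0.ne'⟩
  set c := ∫ x, k x with hc
  have hpi : (2 * Real.pi)⁻¹ ≠ 0 := by positivity
  have hφs : HasCompactSupport (fun t : ℝ => (c⁻¹ * (2 * Real.pi)⁻¹ : ℂ) * χ (t * (2 * Real.pi)⁻¹)) :=
    (hχs.comp_homeomorph (Homeomorph.mulRight₀ _ hpi)).mul_left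
  have hφc : ContDiff ℝ ∞ (fun t : ℝ => (c⁻¹ * (2 * Real.pi)⁻¹ : ℂ) * χ (t * (2 * Real.pi)⁻¹)) := by
    fun_prop
  refine ⟨fun x => c⁻¹ * k x,
    fun t => (c⁻¹ * (2 * Real.pi)⁻¹ : ℂ) * χ (t * (2 * Real.pi)⁻¹), ?_⟩
  constructor
  · exact fun x => mul_nonneg (inv_nonneg.mpr hI.le) (sq_nonneg _)
  · fun_prop
  · intro n
    obtain ⟨C, hC⟩ := hkd n
    refine ⟨c⁻¹ * C, fun x => ?_⟩
    rw [abs_mul, abs_of_pos (inv_pos.mpr hI), mul_left_comm]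
    exact mul_le_mul_of_nonneg_left (hC x) (inv_pos.mpr hI).le
  · rw [integral_const_mul, ← hc, inv_mul_cancel₀ hI.ne']
  · exact hφc.continuous
  · exact hφs
  · exact hφc.lipschitzWith_of_hasCompactSupport hφs (by simp)
  · intro x
    have h1 : S x = ∫ t : ℝ, 𝐞 (-(t * x)) • χ t := Real.fourier_real_eq χ x
    have h2 := Measure.integral_comp_mul_right (fun t : ℝ => 𝐞 (-(t * x)) • χ t) (2 * Real.pi)⁻¹
    rw [← h1, inv_inv, abs_of_pos Real.two_pi_pos] at h2
    have h3 : S x = (2 * Real.pi : ℂ)⁻¹ *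
        ∫ t : ℝ, 𝐞 (-(t * (2 * Real.pi)⁻¹ * x)) • χ (t * (2 * Real.pi)⁻¹) := by
      rw [h2]
      simp only [real_smul, ofReal_mul, ofReal_ofNat]
      have : (Real.pi : ℂ) ≠ 0 := by exact_mod_cast Real.pi_ne_zero
      field_simp
    push_cast
    rw [hk, h3, ← mul_assoc, ← integral_const_mul]
    refine integral_congr_ae (ae_of_all _ fun t => ?_)
    have : (Real.pi : ℂ) ≠ 0 := by exact_mod_cast Real.pi_ne_zero
    simp only [Circle.smul_def, Real.fourierChar_apply, smul_eq_mul]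
    have he : (2 * Real.pi * (-(t * (2 * Real.pi)⁻¹ * x) : ℝ) : ℂ) * I = -(t * x * I) := by
      push_cast
      field_simp
    push_cast at he ⊢
    rw [he]
    ring

theorem rpow_sub_one_le {β y : ℝ} (hβ : 0 < β) (hy : 1 / 2 ≤ y) :
    y ^ (β - 1) ≤ 2 * (max 1 y) ^ ⌈β⌉₊ := by
  have hm : β ≤ ⌈β⌉₊ := Nat.le_ceil β
  have hy0 : 0 < y := by linarith
  rcases le_total 1 y with h | h
  · rw [max_eq_right h, ← Real.rpow_natCast]
    have h1 : y ^ (β - 1) ≤ y ^ (⌈β⌉₊ : ℝ) := Real.rpow_le_rpow_of_exponent_le h (by linarith)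
    have h2 : 0 ≤ y ^ (⌈β⌉₊ : ℝ) := by positivity
    linarith
  · rw [max_eq_left h, one_pow, mul_one]
    calc y ^ (β - 1) ≤ y ^ (-1 : ℝ) := Real.rpow_le_rpow_of_exponent_ge hy0 h (by linarith)
      _ = y⁻¹ := Real.rpow_neg_one y
      _ ≤ 2 := by rw [inv_le_comm₀ hy0 two_pos]; linarith

theorem integrableOn_rpow_sub_one_Ioc {β b : ℝ} (hβ : 0 < β) (hb : 0 ≤ b) :
    IntegrableOn (fun u : ℝ => u ^ (β - 1)) (Ioc 0 b) := by
  rw [← intervalIntegrable_iff_integrableOn_Ioc_of_le hb]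
  exact intervalIntegral.intervalIntegrable_rpow' (by linarith)

theorem integrableOn_rpow_mul_kernel {β : ℝ} (hβ : 0 < β) {K : ℝ → ℝ} (hK : Measurable K)
    (hdec : ∀ n : ℕ, ∃ C, ∀ x, (1 + |x|) ^ n * |K x| ≤ C) (v : ℝ) :
    IntegrableOn (fun u : ℝ => u ^ (β - 1) * K (u - v)) (Ioi 0) := by
  rw [← Ioc_union_Ioi_eq_Ioi zero_le_one]
  refine IntegrableOn.union ?_ ?_
  · obtain ⟨C, hC⟩ := hdec 0
    refine Integrable.mono' ((integrableOn_rpow_sub_one_Ioc hβ zero_le_one).mul_const C)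
      (by fun_prop) ?_
    filter_upwards [ae_restrict_mem measurableSet_Ioc] with u hu
    have h0 : 0 ≤ u ^ (β - 1) := Real.rpow_nonneg hu.1.le _
    rw [norm_mul, Real.norm_of_nonneg h0]
    refine mul_le_mul_of_nonneg_left ?_ h0
    simpa using hC (u - v)
  · have h1 := ((integrable_of_decay hK.aestronglyMeasurable hdec ⌈β⌉₊).comp_sub_right v).norm
    refine Integrable.mono' (h1.const_mul (2 * (1 + |v|) ^ ⌈β⌉₊)).integrableOn (by fun_prop) ?_
    filter_upwards [ae_restrict_mem measurableSet_Ioi] with u hu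
    have hu1 : (1 : ℝ) < u := hu
    have h0 : 0 ≤ u ^ (β - 1) := by positivity
    rw [norm_mul, Real.norm_of_nonneg h0, norm_mul, Real.norm_of_nonneg (r := (1 + |u - v|) ^ _)
      (by positivity), ← mul_assoc]
    refine mul_le_mul_of_nonneg_right ?_ (norm_nonneg _)
    refine (rpow_sub_one_le hβ (by linarith)).trans ?_
    rw [max_eq_right hu1.le, mul_assoc, ← mul_pow]
    have : u ≤ (1 + |v|) * (1 + |u - v|) := by
      nlinarith [abs_nonneg v, abs_nonneg (u - v), le_abs_self v, le_abs_self (u - v),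
        mul_nonneg (abs_nonneg v) (abs_nonneg (u - v))]
    gcongr

/-- Averages of `u ^ (β - 1)` against a rapidly decreasing kernel centred at `v`. -/
theorem tendsto_rpow_mul_integral_kernel {β : ℝ} (hβ : 0 < β) {K : ℝ → ℝ} (hK : Measurable K)
    (hdec : ∀ n : ℕ, ∃ C, ∀ x, (1 + |x|) ^ n * |K x| ≤ C) :
    Tendsto (fun v : ℝ => v ^ (1 - β) * ∫ u in Ioi (0 : ℝ), u ^ (β - 1) * K (u - v)) atTop
      (𝓝 (∫ x, K x)) := by
  have hnear : Tendsto (fun v : ℝ => v ^ (1 - β) * ∫ u in Ioc 0 (v / 2), u ^ (β - 1) * K (u - v))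
      atTop (𝓝 0) := by
    obtain ⟨C, hC⟩ := hdec 2
    have hC0 : 0 ≤ C := le_trans (by positivity) (hC 0)
    refine squeeze_zero_norm' (a := fun v : ℝ => 4 * C / β / v) ?_
      (tendsto_const_nhds.div_atTop tendsto_id)
    filter_upwards [eventually_gt_atTop 0] with v hv
    have hb : ‖∫ u in Ioc 0 (v / 2), u ^ (β - 1) * K (u - v)‖
        ≤ ∫ u in Ioc 0 (v / 2), u ^ (β - 1) * (4 * C / v ^ 2) := by
      refine norm_integral_le_of_norm_le
        ((integrableOn_rpow_sub_one_Ioc hβ (by positivity)).mul_const _) ?_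
      filter_upwards [ae_restrict_mem measurableSet_Ioc] with u hu
      have h0 : 0 ≤ u ^ (β - 1) := Real.rpow_nonneg hu.1.le _
      rw [norm_mul, Real.norm_of_nonneg h0]
      refine mul_le_mul_of_nonneg_left ?_ h0
      rw [le_div_iff₀ (by positivity), Real.norm_eq_abs]
      have h1 : v / 2 ≤ 1 + |u - v| := by
        rw [abs_sub_comm]; linarith [le_abs_self (v - u), hu.2]
      have h2 : (v / 2) ^ 2 * |K (u - v)| ≤ C :=
        le_trans (by gcongr) (hC (u - v))
      nlinarith
    have hintegral : ∫ u in Ioc 0 (v / 2), u ^ (β - 1) = (v / 2) ^ β / β := by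
      rw [← intervalIntegral.integral_of_le (by positivity), integral_rpow (Or.inl (by linarith))]
      simp [Real.zero_rpow hβ.ne']
    rw [integral_mul_const, hintegral] at hb
    rw [norm_mul, Real.norm_of_nonneg (by positivity)]
    have h3 : (v / 2) ^ β ≤ v ^ β := by gcongr; linarith
    calc _ ≤ v ^ (1 - β) * (v ^ β / β * (4 * C / v ^ 2)) := by
          refine mul_le_mul_of_nonneg_left (hb.trans ?_) (by positivity)
          gcongr
      _ = (v ^ (1 - β) * v ^ β) * (4 * C / β / v ^ 2) := by ring
      _ = _ := by
        rw [← Real.rpow_add hv, sub_add_cancel, Real.rpow_one]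
        field_simp
  have hfar : Tendsto (fun v : ℝ => ∫ x, (Ioi (-(v / 2))).indicator
      (fun x => ((v + x) / v) ^ (β - 1) * K x) x) atTop (𝓝 (∫ x, K x)) := by
    have h1 := (integrable_of_decay hK.aestronglyMeasurable hdec ⌈β⌉₊).norm.const_mul 2
    refine tendsto_integral_filter_of_dominated_convergence _ ?_ ?_ h1 ?_
    · exact Eventually.of_forall fun v => Measurable.aestronglyMeasurable
        (Measurable.indicator (by fun_prop) measurableSet_Ioi)
    · filter_upwards [eventually_ge_atTop 1] with v hv
      refine ae_of_all _ fun x => ?_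
      by_cases hx : x ∈ Ioi (-(v / 2))
      · rw [indicator_of_mem hx]
        have hx' : -(v / 2) < x := hx
        have hy : 1 / 2 ≤ (v + x) / v := by
          rw [div_le_div_iff₀ two_pos (by linarith)]; linarith
        have h0 : 0 ≤ ((v + x) / v) ^ (β - 1) := Real.rpow_nonneg (by linarith) _
        rw [norm_mul, norm_mul, Real.norm_of_nonneg h0,
          Real.norm_of_nonneg (r := (1 + |x|) ^ _) (by positivity), ← mul_assoc]
        refine mul_le_mul_of_nonneg_right ?_ (norm_nonneg _)
        refine (rpow_sub_one_le hβ hy).trans ?_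
        have : max 1 ((v + x) / v) ≤ 1 + |x| := by
          refine max_le (by simp) ?_
          rw [div_le_iff₀ (by linarith)]
          nlinarith [abs_nonneg x, le_abs_self x]
        gcongr
      · rw [indicator_of_notMem hx]; simp; positivity
    · refine ae_of_all _ fun x => ?_
      have h2 : Tendsto (fun v : ℝ => ((v + x) / v) ^ (β - 1) * K x) atTop (𝓝 (K x)) := by
        have h3 : Tendsto (fun v : ℝ => (v + x) / v) atTop (𝓝 1) := by
          have : Tendsto (fun v : ℝ => 1 + x / v) atTop (𝓝 (1 + 0)) :=
            tendsto_const_nhds.add (tendsto_const_nhds.div_atTop tendsto_id)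
          rw [add_zero] at this
          refine this.congr' ?_
          filter_upwards [eventually_gt_atTop 0] with v hv
          field_simp
        have h4 := (h3.rpow_const (p := β - 1) (Or.inl one_ne_zero)).mul_const (K x)
        simpa using h4
      refine h2.congr' ?_
      filter_upwards [eventually_gt_atTop (2 * |x|)] with v hv
      rw [indicator_of_mem]
      show -(v / 2) < x
      linarith [neg_abs_le x]
  have hsum := hnear.add hfar
  rw [zero_add] at hsum
  refine hsum.congr' ?_
  filter_upwards [eventually_gt_atTop 0] with v hv
  have hi := integrableOn_rpow_mul_kernel hβ hK hdec v
  have hv2 : 0 ≤ v / 2 := by positivity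
  have hsplit : ∫ u in Ioi (0 : ℝ), u ^ (β - 1) * K (u - v) =
      (∫ u in Ioc 0 (v / 2), u ^ (β - 1) * K (u - v))
        + ∫ u in Ioi (v / 2), u ^ (β - 1) * K (u - v) := by
    rw [← Ioc_union_Ioi_eq_Ioi hv2, setIntegral_union (Ioc_disjoint_Ioi le_rfl) measurableSet_Ioi
      (hi.mono_set Ioc_subset_Ioi_self) (hi.mono_set (Ioi_subset_Ioi hv2))]
  rw [hsplit, mul_add]
  congr 1
  rw [← integral_sub_right_eq_self _ v, ← integral_indicator measurableSet_Ioi,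
    ← integral_const_mul]
  refine integral_congr_ae (ae_of_all _ fun u => ?_)
  by_cases hu : v / 2 < u
  · have hu' : u - v ∈ Ioi (-(v / 2)) := by simp only [mem_Ioi]; linarith
    simp only [indicator_of_mem hu', indicator_of_mem (show u ∈ Ioi (v / 2) from hu)]
    rw [add_sub_cancel, Real.div_rpow (by linarith) hv.le, ← neg_sub β 1, Real.rpow_neg hv.le]
    ring
  · have hu' : u - v ∉ Ioi (-(v / 2)) := by simp only [mem_Ioi]; linarith
    simp only [indicator_of_notMem hu', indicator_of_notMem (show u ∉ Ioi (v / 2) from hu), mul_zero]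

theorem norm_sub_le_variationOnFromTo {g : ℝ → ℂ} (hg : LocallyBoundedVariationOn g univ)
    {s t : ℝ} (hst : s ≤ t) :
    ‖g t - g s‖ ≤ variationOnFromTo g univ 0 t - variationOnFromTo g univ 0 s := by
  rw [variationOnFromTo.sub_right hg (mem_univ _) (mem_univ _) (mem_univ _),
    variationOnFromTo.eq_of_le _ _ hst, ← dist_eq_norm]
  exact BoundedVariationOn.dist_le (hg s t (mem_univ _) (mem_univ _))
    ⟨mem_univ _, hst, le_rfl⟩ ⟨mem_univ _, le_rfl, hst⟩

theorem integral_shift_sub_le_of_monotone {V : ℝ → ℝ} (hV : Monotone V) {a b h : ℝ}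
    (h0 : 0 ≤ h) (h1 : h ≤ 1) :
    ∫ t in a..b, (V (t + h) - V t) ≤ h * (V (b + 1) - V a) := by
  have hi : ∀ c d : ℝ, IntervalIntegrable V volume c d := fun c d => hV.intervalIntegrable
  have hi' : IntervalIntegrable (fun t => V (t + h)) volume a b :=
    (hV.comp (fun x y hxy => by simpa using hxy)).intervalIntegrable
  rw [intervalIntegral.integral_sub hi' (hi _ _), intervalIntegral.integral_comp_add_right,
    intervalIntegral.integral_interval_sub_interval_comm' (hi _ _) (hi _ _) (hi _ _)]
  have hu : ∫ t in b..b + h, V t ≤ ∫ t in b..b + h, V (b + 1) :=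
    intervalIntegral.integral_mono_on (by linarith) (hi _ _) (by simp)
      fun t ht => hV (by linarith [ht.2])
  have hl : ∫ t in a..a + h, V a ≤ ∫ t in a..a + h, V t :=
    intervalIntegral.integral_mono_on (by linarith) (by simp) (hi _ _)
      fun t ht => hV ht.1
  simp only [intervalIntegral.integral_const, add_sub_cancel_left, smul_eq_mul] at hu hl
  linarith

/-- The `L¹`-modulus of continuity of a compactly supported function of bounded variation. -/
theorem exists_integral_norm_shift_sub_le {φ g : ℝ → ℂ} (hφs : HasCompactSupport φ)
    (hφL : ∃ M, LipschitzWith M φ) (hg : Continuous g) (hgV : LocallyBoundedVariationOn g univ) :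
    ∃ C, ∀ h : ℝ, 0 ≤ h → h ≤ 1 → ∫ t, ‖φ (t + h) * g (t + h) - φ t * g t‖ ≤ C * h := by
  obtain ⟨L, hL⟩ := hφL
  have hφc := hL.continuous
  obtain ⟨R, hR0, hR⟩ := hφs.isCompact.isBounded.subset_ball_lt 0 0
  have hφ0 : ∀ t : ℝ, R ≤ |t| → φ t = 0 := by
    intro t ht
    by_contra hne
    have := hR (subset_tsupport φ hne)
    rw [mem_ball_zero_iff, Real.norm_eq_abs] at this
    linarith
  obtain ⟨M, hM⟩ := hφc.bounded_above_of_compact_support hφs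
  obtain ⟨D, hD⟩ := (isCompact_Icc (a := -R - 1) (b := R)).exists_bound_of_continuousOn
    hg.continuousOn
  set a := -R - 1 with ha
  set V := variationOnFromTo g univ 0
  have hV : Monotone V := fun x y hxy =>
    variationOnFromTo.monotoneOn hgV (mem_univ _) (mem_univ _) (mem_univ _) hxy
  have hab : a ≤ R := by linarith
  have hM0 : 0 ≤ M := (norm_nonneg _).trans (hM 0)
  have hD0 : 0 ≤ D := (norm_nonneg _).trans (hD a ⟨le_rfl, hab⟩)
  refine ⟨M * (V (R + 1) - V a) + (R - a) * (D * L), fun h h0 h1 => ?_⟩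
  have hsupp : ∀ t, t ∉ Ioc a R → ‖φ (t + h) * g (t + h) - φ t * g t‖ = 0 := by
    intro t ht
    have : t ≤ a ∨ R < t := by
      by_contra! hcon
      exact ht ⟨hcon.1, hcon.2⟩
    have hz : φ (t + h) = 0 ∧ φ t = 0 := by
      rcases this with h2 | h2
      · exact ⟨hφ0 _ (by linarith [neg_abs_le (t + h)]), hφ0 _ (by linarith [neg_abs_le t])⟩
      · exact ⟨hφ0 _ (by linarith [le_abs_self (t + h)]), hφ0 _ (by linarith [le_abs_self t])⟩
    simp [hz.1, hz.2]
  rw [← setIntegral_eq_integral_of_forall_compl_eq_zero hsupp,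
    ← intervalIntegral.integral_of_le hab]
  have hiV : IntervalIntegrable (fun t => V (t + h) - V t) volume a R :=
    ((hV.comp (fun x y hxy => by simpa using hxy)).intervalIntegrable).sub hV.intervalIntegrable
  calc ∫ t in a..R, ‖φ (t + h) * g (t + h) - φ t * g t‖
      ≤ ∫ t in a..R, (M * (V (t + h) - V t) + D * L * h) := by
        refine intervalIntegral.integral_mono_on hab ?_ ((hiV.const_mul M).add (by simp)) ?_
        · exact Continuous.intervalIntegrable (by fun_prop) _ _
        · intro t ht
          have e : φ (t + h) * g (t + h) - φ t * g t
              = φ (t + h) * (g (t + h) - g t) + g t * (φ (t + h) - φ t) := by ring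
          rw [e]
          refine (norm_add_le _ _).trans ?_
          rw [norm_mul, norm_mul, mul_assoc D]
          have hLip : ‖φ (t + h) - φ t‖ ≤ L * h := by
            simpa [dist_eq_norm, abs_of_nonneg h0] using hL.dist_le_mul (t + h) t
          have hVar : ‖g (t + h) - g t‖ ≤ V (t + h) - V t :=
            norm_sub_le_variationOnFromTo hgV (by linarith)
          exact add_le_add (mul_le_mul (hM _) hVar (norm_nonneg _) hM0)
            (mul_le_mul (hD t ht) hLip (norm_nonneg _) hD0)
    _ = M * (∫ t in a..R, (V (t + h) - V t)) + (R - a) * (D * L * h) := by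
        rw [intervalIntegral.integral_add (hiV.const_mul M) (by simp),
          intervalIntegral.integral_const_mul]
        simp only [intervalIntegral.integral_const, smul_eq_mul]
    _ ≤ M * (h * (V (R + 1) - V a)) + (R - a) * (D * L * h) := by
        gcongr
        exact integral_shift_sub_le_of_monotone hV h0 h1
    _ = _ := by ring

theorem norm_integral_mul_cexp_le {p : ℝ → ℂ} (hp : Integrable p) {v : ℝ} (hv : 0 < v) :
    ‖∫ t : ℝ, p t * Complex.exp (t * v * I)‖ ≤ ∫ t, ‖p (t + Real.pi / v) - p t‖ := by
  have hv' : (v : ℂ) ≠ 0 := by exact_mod_cast hv.ne'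
  have hintegral : ∀ q : ℝ → ℂ, Integrable q → Integrable fun t : ℝ => q t * Complex.exp (t * v * I) := by
    intro q hq
    refine hq.mul_bdd (c := 1) (Continuous.aestronglyMeasurable (by fun_prop)) (ae_of_all _ fun t => ?_)
    rw [← ofReal_mul, norm_exp_ofReal_mul_I]
  have hshift : ∫ t : ℝ, p (t + Real.pi / v) * Complex.exp (t * v * I)
      = -∫ t : ℝ, p t * Complex.exp (t * v * I) := by
    rw [← integral_add_right_eq_self (fun t : ℝ => p t * Complex.exp (t * v * I)) (Real.pi / v),
      ← integral_neg]
    refine integral_congr_ae (ae_of_all _ fun t => ?_)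
    have : ((t + Real.pi / v : ℝ) : ℂ) * v * I = t * v * I + Real.pi * I := by
      push_cast; field_simp
    simp only [this, Complex.exp_add, exp_pi_mul_I]
    ring
  have hp' := hp.comp_add_right (Real.pi / v)
  have hkey : ∫ t : ℝ, (p (t + Real.pi / v) - p t) * Complex.exp (t * v * I)
      = -(2 * ∫ t : ℝ, p t * Complex.exp (t * v * I)) := by
    simp_rw [sub_mul]
    rw [integral_sub (hintegral _ hp') (hintegral _ hp), hshift]
    ring
  have hle : ‖∫ t : ℝ, (p (t + Real.pi / v) - p t) * Complex.exp (t * v * I)‖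
      ≤ ∫ t, ‖p (t + Real.pi / v) - p t‖ := by
    refine (norm_integral_le_integral_norm _).trans (le_of_eq ?_)
    refine integral_congr_ae (ae_of_all _ fun t => ?_)
    simp only [norm_mul]
    rw [← ofReal_mul, norm_exp_ofReal_mul_I, mul_one]
  rw [hkey, norm_neg, norm_mul] at hle
  simp only [Complex.norm_ofNat] at hle
  linarith [norm_nonneg (∫ t : ℝ, p t * Complex.exp (t * v * I))]

/-- Decay of the oscillatory error term. -/
theorem tendsto_rpow_mul_norm_oscillatory {φ g : ℝ → ℂ} (hφs : HasCompactSupport φ)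
    (hφL : ∃ M, LipschitzWith M φ) (hg : Continuous g) {α : ℝ} (hα : 0 < α)
    (hBV : α < 1 → ∀ a b : ℝ, BoundedVariationOn g (Icc a b)) :
    Tendsto (fun v : ℝ => v ^ (1 - α) * ‖∫ t : ℝ, φ t * g t * Complex.exp (t * v * I)‖) atTop
      (𝓝 0) := by
  rcases lt_or_ge α 1 with h1 | h1
  · have hgV : LocallyBoundedVariationOn g univ := fun a b _ _ =>
      (hBV h1 a b).mono inter_subset_right
    obtain ⟨C, hC⟩ := exists_integral_norm_shift_sub_le hφs hφL hg hgV
    have hφc : Continuous φ := hφL.choose_spec.continuous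
    have hp : Integrable (fun t => φ t * g t) :=
      (hφc.mul hg).integrable_of_hasCompactSupport hφs.mul_right
    have hlim : Tendsto (fun v : ℝ => C * Real.pi * v ^ (-α)) atTop (𝓝 0) := by
      simpa using (tendsto_rpow_neg_atTop hα).const_mul (C * Real.pi)
    refine squeeze_zero' ?_ ?_ hlim
    · filter_upwards [eventually_ge_atTop 0] with v hv
      positivity
    · filter_upwards [eventually_ge_atTop Real.pi] with v hv
      have hv0 : 0 < v := Real.pi_pos.trans_le hv
      have h2 := (norm_integral_mul_cexp_le hp hv0).trans
        (hC (Real.pi / v) (by positivity) ((div_le_one hv0).mpr hv))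
      calc _ ≤ v ^ (1 - α) * (C * (Real.pi / v)) := by gcongr
        _ = _ := by
          rw [sub_eq_add_neg, Real.rpow_add hv0, Real.rpow_one]
          field_simp
  · have hRL := (Real.tendsto_integral_exp_smul_cocompact (fun t => φ t * g t)).norm
    have hscale : Tendsto (fun v : ℝ => -(v / (2 * Real.pi))) atTop (cocompact ℝ) :=
      (tendsto_neg_atTop_atBot.comp (tendsto_id.atTop_div_const Real.two_pi_pos)).mono_right
        atBot_le_cocompact
    have h2 := hRL.comp hscale
    rw [norm_zero] at h2
    refine squeeze_zero' ?_ ?_ h2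
    · filter_upwards [eventually_ge_atTop 0] with v hv
      positivity
    · filter_upwards [eventually_ge_atTop 1] with v hv
      refine (mul_le_of_le_one_left (norm_nonneg _)
        (Real.rpow_le_one_of_one_le_of_nonpos hv (by linarith))).trans (le_of_eq ?_)
      simp only [Function.comp_apply]
      congr 1
      refine integral_congr_ae (ae_of_all _ fun t => ?_)
      have hpi : (Real.pi : ℂ) ≠ 0 := by exact_mod_cast Real.pi_ne_zero
      have he : ((2 * Real.pi * -(t * -(v / (2 * Real.pi))) : ℝ) : ℂ) * I = t * v * I := by
        push_cast
        field_simp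
      simp only [Circle.smul_def, Real.fourierChar_apply, smul_eq_mul]
      rw [he]
      ring

theorem tendsto_exp_neg_div_mul (u : ℝ) :
    Tendsto (fun n : ℕ => Real.exp (-(1 / ((n : ℝ) + 1) * u))) atTop (𝓝 1) := by
  have h : Tendsto (fun n : ℕ => -(1 / ((n : ℝ) + 1) * u)) atTop (𝓝 0) := by
    simpa using (tendsto_one_div_add_atTop_nhds_zero_nat (𝕜 := ℝ)).mul_const (-u)
  simpa [Function.comp_def] using (Real.continuous_exp.tendsto 0).comp h

theorem tendsto_integral_mul_exp_neg {W : ℝ → ℂ} (hW : IntegrableOn W (Ioi 0)) :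
    Tendsto (fun n : ℕ => ∫ u in Ioi (0 : ℝ), W u * (Real.exp (-(1 / ((n : ℝ) + 1) * u)) : ℝ))
      atTop (𝓝 (∫ u in Ioi (0 : ℝ), W u)) := by
  refine tendsto_integral_of_dominated_convergence (fun u => ‖W u‖) ?_ hW.norm ?_ ?_
  · exact fun n => hW.aestronglyMeasurable.mul
      (Continuous.aestronglyMeasurable (by fun_prop))
  · intro n
    filter_upwards [ae_restrict_mem measurableSet_Ioi] with u hu
    have hu' : 0 < u := hu
    rw [norm_mul, norm_real, Real.norm_of_nonneg (Real.exp_pos _).le]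
    refine mul_le_of_le_one_right (norm_nonneg _) (Real.exp_le_one_iff.mpr ?_)
    rw [neg_nonpos]
    positivity
  · refine ae_of_all _ fun u => ?_
    have := (Complex.continuous_ofReal.tendsto _).comp (tendsto_exp_neg_div_mul u)
    simpa using this.const_mul (W u)

/-- Abelian regularisation: if the damped integrals of a nonnegative function converge, the
function is integrable. -/
theorem integrableOn_of_tendsto_integral_mul_exp_neg {W : ℝ → ℝ} (hWm : Measurable W)
    (hW0 : ∀ u, 0 ≤ W u)
    (hWi : ∀ δ : ℝ, 0 < δ → IntegrableOn (fun u => W u * Real.exp (-(δ * u))) (Ioi 0)) {ℓ : ℝ}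
    (hlim : Tendsto (fun n : ℕ => ∫ u in Ioi (0 : ℝ), W u * Real.exp (-(1 / ((n : ℝ) + 1) * u)))
      atTop (𝓝 ℓ)) :
    IntegrableOn W (Ioi 0) := by
  refine ⟨hWm.aestronglyMeasurable, ?_⟩
  rw [hasFiniteIntegral_iff_ofReal (ae_of_all _ hW0)]
  have hfatou := lintegral_liminf_le (μ := volume.restrict (Ioi (0 : ℝ))) (u := atTop)
    (f := fun (n : ℕ) u => ENNReal.ofReal (W u * Real.exp (-(1 / ((n : ℝ) + 1) * u))))
    (fun n => by fun_prop)
  have hpt : ∀ u, liminf (fun n : ℕ =>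
      ENNReal.ofReal (W u * Real.exp (-(1 / ((n : ℝ) + 1) * u)))) atTop = ENNReal.ofReal (W u) := by
    intro u
    have := ENNReal.tendsto_ofReal ((tendsto_exp_neg_div_mul u).const_mul (W u))
    rw [mul_one] at this
    exact this.liminf_eq
  have hintegral : liminf (fun n : ℕ => ∫⁻ u in Ioi (0 : ℝ),
      ENNReal.ofReal (W u * Real.exp (-(1 / ((n : ℝ) + 1) * u)))) atTop = ENNReal.ofReal ℓ := by
    refine ((ENNReal.tendsto_ofReal hlim).congr fun n => ?_).liminf_eq
    exact ofReal_integral_eq_lintegral_ofReal (hWi _ (by positivity))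
      (ae_of_all _ fun u => mul_nonneg (hW0 u) (Real.exp_pos _).le)
  simp only [hpt] at hfatou
  rw [hintegral] at hfatou
  exact hfatou.trans_lt ENNReal.ofReal_lt_top

/-- Pairing a Laplace transform on a vertical line with the transform of a kernel. -/
theorem IsBandLimitedKernel.integral_mul_kernel_eq {K : ℝ → ℝ} {φ : ℝ → ℂ}
    (h : IsBandLimitedKernel K φ) {W : ℝ → ℂ} (hW : IntegrableOn W (Ioi 0)) (v : ℝ) :
    ∫ u in Ioi (0 : ℝ), W u * K (u - v) =
      ∫ t : ℝ, φ t * (∫ u in Ioi (0 : ℝ), W u * Complex.exp (-(t * u * I)))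
        * Complex.exp (t * v * I) := by
  have hφi : Integrable φ := h.continuous_transform.integrable_of_hasCompactSupport
    h.compact_transform
  have hprod : Integrable (Function.uncurry fun (u t : ℝ) =>
      W u * (φ t * Complex.exp (-(t * (u - v : ℝ) * I)))) ((volume.restrict (Ioi 0)).prod volume) := by
    have h1 := Integrable.mul_prod hW hφi
    have h2 : Integrable (fun z : ℝ × ℝ => W z.1 * φ z.2 *
        Complex.exp (-(z.2 * (z.1 - v : ℝ) * I))) ((volume.restrict (Ioi 0)).prod volume) := by
      refine h1.mul_bdd (c := 1) (Continuous.aestronglyMeasurable (by fun_prop))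
        (ae_of_all _ fun z => ?_)
      rw [← neg_mul, ← ofReal_mul, ← ofReal_neg, norm_exp_ofReal_mul_I]
    refine h2.congr (ae_of_all _ fun z => ?_)
    simp only [Function.uncurry]
    ring
  calc ∫ u in Ioi (0 : ℝ), W u * K (u - v)
      = ∫ u in Ioi (0 : ℝ), ∫ t : ℝ, W u * (φ t * Complex.exp (-(t * (u - v : ℝ) * I))) := by
        refine integral_congr_ae (ae_of_all _ fun u => ?_)
        simp only [h.eq_integral, integral_const_mul]
    _ = ∫ t : ℝ, ∫ u in Ioi (0 : ℝ), W u * (φ t * Complex.exp (-(t * (u - v : ℝ) * I))) :=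
        integral_integral_swap hprod
    _ = _ := by
        refine integral_congr_ae (ae_of_all _ fun t => ?_)
        simp only
        rw [← integral_const_mul, ← integral_mul_const]
        refine integral_congr_ae (ae_of_all _ fun u => ?_)
        simp only
        have : -((t : ℂ) * ((u - v : ℝ) : ℂ) * I) = -(t * u * I) + t * v * I := by
          push_cast; ring
        rw [this, Complex.exp_add]
        ring

/-- The Laplace transform identity carried to the boundary line and tested against a kernel. -/
theorem IsBandLimitedKernel.boundary_identity {K : ℝ → ℝ} {φ : ℝ → ℂ}
    (h : IsBandLimitedKernel K φ) {B : ℝ → ℝ} (hB0 : ∀ u, 0 ≤ B u) (hBm : Measurable B)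
    (hBi : ∀ δ : ℝ, 0 < δ → IntegrableOn (fun u => B u * Real.exp (-(δ * u))) (Ioi 0))
    {D : ℝ → ℂ}
    (hDi : ∀ δ : ℝ, 0 < δ → IntegrableOn (fun u => D u * Real.exp (-(δ * u))) (Ioi 0))
    {v : ℝ} (hDK : IntegrableOn (fun u => D u * K (u - v)) (Ioi 0))
    {H : ℂ → ℂ} (hHc : ContinuousOn H {z | 0 ≤ z.re})
    (hH : ∀ z : ℂ, 0 < z.re →
      H z = ∫ u in Ioi (0 : ℝ), ((B u : ℂ) - D u) * Complex.exp (-z * u)) :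
    IntegrableOn (fun u => B u * K (u - v)) (Ioi 0) ∧
      ((∫ u in Ioi (0 : ℝ), B u * K (u - v) : ℝ) : ℂ) = (∫ u in Ioi (0 : ℝ), D u * K (u - v))
        + ∫ t : ℝ, φ t * H (t * I) * Complex.exp (t * v * I) := by
  obtain ⟨M, hM⟩ := h.decay 0
  have hKb : ∀ x, ‖K x‖ ≤ M := fun x => by simpa using hM x
  have hKm : Measurable K := h.continuous.measurable
  have hBKi : ∀ δ : ℝ, 0 < δ →
      IntegrableOn (fun u => B u * K (u - v) * Real.exp (-(δ * u))) (Ioi 0) := by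
    intro δ hδ
    have := (hBi δ hδ).mul_bdd (c := M) (g := fun u => K (u - v))
      (Measurable.aestronglyMeasurable (by fun_prop)) (ae_of_all _ fun u => hKb _)
    exact this.congr (ae_of_all _ fun u => by simp only; ring)
  have hDKi : ∀ δ : ℝ, 0 < δ →
      IntegrableOn (fun u => D u * K (u - v) * (Real.exp (-(δ * u)) : ℝ)) (Ioi 0) := by
    intro δ hδ
    have := (hDi δ hδ).mul_bdd (c := M) (g := fun u => (K (u - v) : ℂ))
      (Measurable.aestronglyMeasurable (by fun_prop)) (ae_of_all _ fun u => by simpa using hKb _)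
    exact this.congr (ae_of_all _ fun u => by simp only; ring)
  have hdamped : ∀ δ : ℝ, 0 < δ →
      ((∫ u in Ioi (0 : ℝ), B u * K (u - v) * Real.exp (-(δ * u)) : ℝ) : ℂ)
        = (∫ u in Ioi (0 : ℝ), D u * K (u - v) * (Real.exp (-(δ * u)) : ℝ))
          + ∫ t : ℝ, φ t * H (δ + t * I) * Complex.exp (t * v * I) := by
    intro δ hδ
    have hWi : IntegrableOn (fun u => ((B u : ℂ) - D u) * (Real.exp (-(δ * u)) : ℝ)) (Ioi 0) := by
      refine ((hBi δ hδ).ofReal (𝕜 := ℂ) |>.sub (hDi δ hδ)).congr (ae_of_all _ fun u => ?_)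
      simp [sub_mul]
    have hid := h.integral_mul_kernel_eq hWi v
    have hr : ∫ t : ℝ, φ t * H (δ + t * I) * Complex.exp (t * v * I)
        = ∫ u in Ioi (0 : ℝ), ((B u : ℂ) - D u) * (Real.exp (-(δ * u)) : ℝ) * K (u - v) := by
      rw [hid]
      refine integral_congr_ae (ae_of_all _ fun t => ?_)
      simp only
      rw [hH _ (by simpa using hδ)]
      congr 2
      refine integral_congr_ae (ae_of_all _ fun u => ?_)
      simp only
      rw [mul_assoc, ofReal_exp, ← Complex.exp_add]
      congr 2
      push_cast
      ring
    rw [hr, ← integral_complex_ofReal, ← integral_add (hDKi δ hδ)]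
    · refine integral_congr_ae (ae_of_all _ fun u => ?_)
      push_cast
      ring
    · refine ((hBKi δ hδ).ofReal (𝕜 := ℂ) |>.sub (hDKi δ hδ)).congr (ae_of_all _ fun u => ?_)
      simp only [Pi.sub_apply, coe_algebraMap, ofReal_mul]
      ring
  have hosc : Tendsto (fun n : ℕ => ∫ t : ℝ, φ t * H ((1 / ((n : ℝ) + 1) : ℝ) + t * I) *
      Complex.exp (t * v * I)) atTop
        (𝓝 (∫ t : ℝ, φ t * H (t * I) * Complex.exp (t * v * I))) := by
    have hcomp : ContinuousOn (fun z : ℝ × ℝ => H (z.1 + z.2 * I)) (Icc 0 1 ×ˢ univ) := by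
      refine hHc.comp (Continuous.continuousOn (by fun_prop)) ?_
      rintro ⟨a, b⟩ ⟨ha, -⟩
      simpa using ha.1
    obtain ⟨N, hN⟩ := ((isCompact_Icc (a := (0 : ℝ)) (b := 1)).prod
      h.compact_transform.isCompact).exists_bound_of_continuousOn
        (hcomp.mono (prod_mono le_rfl (subset_univ _)))
    have hmem : ∀ n : ℕ, (1 / ((n : ℝ) + 1)) ∈ Icc (0 : ℝ) 1 := fun n =>
      ⟨by positivity, by rw [div_le_one (by positivity)]; linarith [n.cast_nonneg (α := ℝ)]⟩
    have hφi : Integrable φ := h.continuous_transform.integrable_of_hasCompactSupport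
      h.compact_transform
    refine tendsto_integral_of_dominated_convergence (fun t => ‖φ t‖ * N) ?_
      (hφi.norm.mul_const N) ?_ ?_
    · intro n
      have hc : Continuous fun t : ℝ => H ((1 / ((n : ℝ) + 1) : ℝ) + t * I) := by
        rw [← continuousOn_univ]
        exact hcomp.comp (f := fun t : ℝ => ((1 / ((n : ℝ) + 1) : ℝ), t)) (by fun_prop)
          fun t _ => ⟨hmem n, mem_univ _⟩
      exact ((h.continuous_transform.mul hc).mul (by fun_prop)).aestronglyMeasurable
    · intro n
      refine ae_of_all _ fun t => ?_
      rw [norm_mul, ← ofReal_mul, norm_exp_ofReal_mul_I, mul_one, norm_mul]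
      by_cases ht : t ∈ tsupport φ
      · exact mul_le_mul_of_nonneg_left (hN (_, t) ⟨hmem n, ht⟩) (norm_nonneg _)
      · simp [image_eq_zero_of_notMem_tsupport ht]
    · refine ae_of_all _ fun t => ?_
      refine ((tendsto_const_nhds (x := φ t)).mul ?_).mul_const _
      have h1 : ContinuousWithinAt (fun δ : ℝ => H (δ + t * I)) (Icc 0 1) 0 :=
        (hcomp.comp (f := fun δ : ℝ => (δ, t)) (by fun_prop)
          fun δ hδ => ⟨hδ, mem_univ _⟩) 0 (by simp)
      have h2 : Tendsto (fun n : ℕ => (1 / ((n : ℝ) + 1))) atTop (𝓝[Icc 0 1] 0) :=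
        tendsto_nhdsWithin_iff.mpr
          ⟨tendsto_one_div_add_atTop_nhds_zero_nat, Eventually.of_forall hmem⟩
      simpa [Function.comp_def] using h1.tendsto.comp h2
  have hlim := (tendsto_integral_mul_exp_neg hDK).add hosc
  have hlimC := hlim.congr fun n : ℕ => (hdamped (1 / ((n : ℝ) + 1)) (by positivity)).symm
  have hlimR := (Complex.continuous_re.tendsto _).comp hlimC
  have hintegral : IntegrableOn (fun u => B u * K (u - v)) (Ioi 0) :=
    integrableOn_of_tendsto_integral_mul_exp_neg (by fun_prop)
      (fun u => mul_nonneg (hB0 u) (h.nonneg _)) hBKi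
      (hlimR.congr fun n => by simp only [Function.comp_apply, ofReal_re])
  refine ⟨hintegral, ?_⟩
  have h3 := tendsto_integral_mul_exp_neg (W := fun u => ((B u * K (u - v) : ℝ) : ℂ)) hintegral.ofReal
  refine tendsto_nhds_unique ?_ hlimC
  rw [← integral_complex_ofReal]
  refine h3.congr fun n => ?_
  rw [← integral_complex_ofReal]
  refine integral_congr_ae (ae_of_all _ fun u => ?_)
  push_cast
  ring

theorem tendsto_rpow_mul_shift {Y : ℝ → ℝ} {γ l : ℝ}
    (hY : Tendsto (fun v : ℝ => v ^ γ * Y v) atTop (𝓝 l)) (h : ℝ) :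
    Tendsto (fun w : ℝ => w ^ γ * Y (w + h)) atTop (𝓝 l) := by
  have h1 : Tendsto (fun w : ℝ => w + h) atTop atTop := tendsto_atTop_add_const_right _ h tendsto_id
  have h2 : Tendsto (fun w : ℝ => w / (w + h)) atTop (𝓝 1) := by
    have : Tendsto (fun w : ℝ => 1 - h / (w + h)) atTop (𝓝 (1 - 0)) :=
      tendsto_const_nhds.sub (tendsto_const_nhds.div_atTop h1)
    rw [sub_zero] at this
    refine this.congr' ?_
    filter_upwards [h1.eventually_gt_atTop 0] with w hw
    field_simp
    ring
  have h3 := (h2.rpow_const (p := γ) (Or.inl one_ne_zero)).mul (hY.comp h1)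
  rw [Real.one_rpow, one_mul] at h3
  refine h3.congr' ?_
  filter_upwards [eventually_gt_atTop 0, h1.eventually_gt_atTop 0] with w hw hw'
  have : (w + h) ^ γ ≠ 0 := (Real.rpow_pos_of_pos hw' _).ne'
  simp only [Function.comp_apply]
  rw [Real.div_rpow hw.le hw'.le]
  field_simp

theorem exists_isBandLimitedKernel_concentrated {h θ : ℝ} (hh : 0 < h) (hθ : θ < 1) :
    ∃ K φ, IsBandLimitedKernel K φ ∧ θ < ∫ x in Ioc (-h) h, K x := by
  obtain ⟨K, φ, hK⟩ := exists_isBandLimitedKernel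
  have h1 : Tendsto (fun c : ℝ => ∫ x in (-(c * h))..(c * h), K x) atTop (𝓝 (∫ x, K x)) := by
    have h2 : Tendsto (fun c : ℝ => c * h) atTop atTop := tendsto_id.atTop_mul_const hh
    exact intervalIntegral_tendsto_integral hK.integrable (tendsto_neg_atTop_atBot.comp h2) h2
  rw [hK.integral_eq_one] at h1
  obtain ⟨c, hc, hc0⟩ := ((h1.eventually_const_lt hθ).and (eventually_gt_atTop 0)).exists
  refine ⟨_, _, hK.scale hc0, ?_⟩
  rw [← intervalIntegral.integral_of_le (by linarith), intervalIntegral.integral_const_mul,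
    intervalIntegral.mul_integral_comp_mul_left]
  simpa using hc

section Tauberian

variable {B : ℝ → ℝ}

theorem le_exp_mul_of_exp_mul_monotone (hmono : Monotone fun u => Real.exp u * B u) {x y : ℝ}
    (hxy : x ≤ y) : B x ≤ Real.exp (y - x) * B y := by
  have := hmono hxy
  simp only at this
  rw [Real.exp_sub, div_mul_eq_mul_div, le_div_iff₀ (Real.exp_pos _)]
  linarith

variable {K : ℝ → ℝ} {φ : ℝ → ℂ}

theorem setIntegral_Ioc_kernel_shift (v h : ℝ) :
    ∫ u in Ioc (v - h) (v + h), K (u - v) = ∫ x in Ioc (-h) h, K x := by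
  by_cases hh : -h ≤ h
  · rw [← intervalIntegral.integral_of_le (by linarith), ← intervalIntegral.integral_of_le hh,
      intervalIntegral.integral_comp_sub_right]
    congr 1 <;> ring
  · rw [Ioc_eq_empty (by linarith), Ioc_eq_empty (by linarith)]
    simp

theorem IsBandLimitedKernel.le_integral_of_exp_mul_monotone (hK : IsBandLimitedKernel K φ)
    (hB0 : ∀ u, 0 ≤ B u) (hmono : Monotone fun u => Real.exp u * B u)
    {w h : ℝ} (hw : 0 ≤ w)
    (hi : IntegrableOn (fun u => B u * K (u - (w + h))) (Ioi 0)) :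
    Real.exp (-(2 * h)) * (∫ x in Ioc (-h) h, K x) * B w
      ≤ ∫ u in Ioi (0 : ℝ), B u * K (u - (w + h)) := by
  rw [← setIntegral_Ioc_kernel_shift (w + h) h]
  have hsub : Ioc (w + h - h) (w + h + h) ⊆ Ioi 0 := fun u hu => by
    have := hu.1
    simp only [mem_Ioi]; linarith
  calc _ = ∫ u in Ioc (w + h - h) (w + h + h), Real.exp (-(2 * h)) * B w * K (u - (w + h)) := by
        rw [integral_const_mul]; ring
    _ ≤ ∫ u in Ioc (w + h - h) (w + h + h), B u * K (u - (w + h)) := by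
        refine setIntegral_mono_on ((hK.integrable.comp_sub_right _).integrableOn.const_mul _)
          (hi.mono_set hsub) measurableSet_Ioc fun u hu => ?_
        refine mul_le_mul_of_nonneg_right ?_ (hK.nonneg _)
        have h1 := le_exp_mul_of_exp_mul_monotone hmono (show w ≤ u by linarith [hu.1])
        have h2 : Real.exp (u - w) ≤ Real.exp (2 * h) := Real.exp_le_exp.mpr (by linarith [hu.2])
        rw [Real.exp_neg, inv_mul_le_iff₀ (Real.exp_pos _)]
        exact h1.trans (mul_le_mul_of_nonneg_right h2 (hB0 u))
    _ ≤ _ := setIntegral_mono_set hi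
        (ae_of_all _ fun u => mul_nonneg (hB0 u) (hK.nonneg _)) hsub.eventuallyLE

theorem IsBandLimitedKernel.integral_le_of_exp_mul_monotone (hK : IsBandLimitedKernel K φ)
    (hB0 : ∀ u, 0 ≤ B u) (hmono : Monotone fun u => Real.exp u * B u)
    {v h : ℝ} {P : ℝ → ℝ} (hP : ∀ u, 0 < u → B u ≤ P u) (hhv : h ≤ v)
    (hi : IntegrableOn (fun u => B u * K (u - v)) (Ioi 0))
    (hPi : IntegrableOn (fun u => P u * (Ioc (-h) h)ᶜ.indicator K (u - v)) (Ioi 0)) :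
    ∫ u in Ioi (0 : ℝ), B u * K (u - v) ≤ Real.exp (2 * h) * B (v + h)
      + ∫ u in Ioi (0 : ℝ), P u * (Ioc (-h) h)ᶜ.indicator K (u - v) := by
  have hsub : Ioc (v - h) (v + h) ⊆ Ioi 0 := fun u hu => by
    have := hu.1
    simp only [mem_Ioi]; linarith
  rw [← integral_inter_add_sdiff measurableSet_Ioc hi (s := Ioi 0) (t := Ioc (v - h) (v + h)),
    inter_eq_right.mpr hsub]
  refine add_le_add ?_ ?_
  · calc ∫ u in Ioc (v - h) (v + h), B u * K (u - v)
        ≤ ∫ u in Ioc (v - h) (v + h), Real.exp (2 * h) * B (v + h) * K (u - v) := by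
          refine setIntegral_mono_on (hi.mono_set hsub)
            ((hK.integrable.comp_sub_right _).integrableOn.const_mul _)
            measurableSet_Ioc fun u hu => ?_
          refine mul_le_mul_of_nonneg_right ?_ (hK.nonneg _)
          have h1 := le_exp_mul_of_exp_mul_monotone hmono hu.2
          have h2 : Real.exp (v + h - u) ≤ Real.exp (2 * h) :=
            Real.exp_le_exp.mpr (by linarith [hu.1])
          exact h1.trans (mul_le_mul_of_nonneg_right h2 (hB0 _))
      _ ≤ Real.exp (2 * h) * B (v + h) * 1 := by
          rw [integral_const_mul, setIntegral_Ioc_kernel_shift, ← hK.integral_eq_one]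
          refine mul_le_mul_of_nonneg_left ?_ (mul_nonneg (Real.exp_pos _).le (hB0 _))
          exact setIntegral_le_integral hK.integrable (ae_of_all _ hK.nonneg)
      _ = _ := mul_one _
  · have hmeas : MeasurableSet (Ioi (0 : ℝ) \ Ioc (v - h) (v + h)) :=
      measurableSet_Ioi.diff measurableSet_Ioc
    have hK'0 : ∀ x, 0 ≤ (Ioc (-h) h)ᶜ.indicator K x :=
      indicator_nonneg fun x _ => hK.nonneg x
    calc ∫ u in Ioi 0 \ Ioc (v - h) (v + h), B u * K (u - v)
        ≤ ∫ u in Ioi 0 \ Ioc (v - h) (v + h), P u * (Ioc (-h) h)ᶜ.indicator K (u - v) := by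
          refine setIntegral_mono_on (hi.mono_set sdiff_subset) (hPi.mono_set sdiff_subset) hmeas
            fun u hu => ?_
          have hmem : u - v ∈ (Ioc (-h) h)ᶜ := fun hc =>
            hu.2 ⟨by linarith [hc.1], by linarith [hc.2]⟩
          rw [indicator_of_mem hmem]
          exact mul_le_mul_of_nonneg_right (hP u hu.1) (hK.nonneg _)
      _ ≤ _ := by
          refine setIntegral_mono_set hPi ?_ sdiff_subset.eventuallyLE
          filter_upwards [ae_restrict_mem measurableSet_Ioi] with u hu
          exact mul_nonneg ((hB0 u).trans (hP u hu)) (hK'0 _)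

theorem tendsto_rpow_mul_integral_kernel_of_lt {α β : ℝ} (hβ : 0 < β) (hβα : β < α)
    (hK : Measurable K) (hdec : ∀ n : ℕ, ∃ C, ∀ x, (1 + |x|) ^ n * |K x| ≤ C) :
    Tendsto (fun v : ℝ => v ^ (1 - α) * ∫ u in Ioi (0 : ℝ), u ^ (β - 1) * K (u - v)) atTop
      (𝓝 0) := by
  have h1 := (tendsto_rpow_neg_atTop (sub_pos.mpr hβα)).mul
    (tendsto_rpow_mul_integral_kernel hβ hK hdec)
  rw [zero_mul] at h1
  refine h1.congr' ?_
  filter_upwards [eventually_gt_atTop 0] with v hv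
  rw [← mul_assoc, ← Real.rpow_add hv]
  congr 2
  ring

/-- The Tauberian step: kernel averages determine a slowly decreasing function. -/
theorem tendsto_of_tendsto_kernel_averages (hB0 : ∀ u, 0 ≤ B u)
    (hmono : Monotone fun u => Real.exp u * B u) {α L : ℝ} (hα : 0 < α)
    (hT : ∀ K φ, IsBandLimitedKernel K φ →
      (∀ v, IntegrableOn (fun u => B u * K (u - v)) (Ioi 0)) ∧
      Tendsto (fun v : ℝ => v ^ (1 - α) * ∫ u in Ioi (0 : ℝ), B u * K (u - v)) atTop (𝓝 L)) :
    Tendsto (fun v : ℝ => v ^ (1 - α) * B v) atTop (𝓝 L) := by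
  have hL : 0 ≤ L := by
    obtain ⟨K, φ, hK⟩ := exists_isBandLimitedKernel
    refine ge_of_tendsto (hT K φ hK).2 ?_
    filter_upwards [eventually_ge_atTop 0] with v hv
    exact mul_nonneg (Real.rpow_nonneg hv _)
      (integral_nonneg fun u => mul_nonneg (hB0 u) (hK.nonneg _))
  have hupper : ∀ b, L < b → ∀ᶠ w in atTop, w ^ (1 - α) * B w < b := by
    intro b hb
    have hx : Tendsto (fun x : ℝ => Real.exp (2 * x) / (1 - x) * L) (𝓝[>] 0) (𝓝 L) := by
      have hc : ContinuousAt (fun x : ℝ => Real.exp (2 * x) / (1 - x) * L) 0 := by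
        refine ContinuousAt.mul (ContinuousAt.div (by fun_prop) (by fun_prop) (by simp))
          continuousAt_const
      have := hc.tendsto
      simp only [mul_zero, Real.exp_zero, sub_zero, div_one, one_mul] at this
      exact this.mono_left nhdsWithin_le_nhds
    obtain ⟨x, hxb, hx0, hx1⟩ := ((hx.eventually_lt_const hb).and
      (Ioo_mem_nhdsGT (zero_lt_one' ℝ))).exists
    obtain ⟨K, φ, hK, hm⟩ :=
      exists_isBandLimitedKernel_concentrated hx0 (show 1 - x < 1 by linarith)
    obtain ⟨hi, hlim⟩ := hT K φ hK
    set m := ∫ y in Ioc (-x) x, K y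
    have hm0 : 0 < m := by linarith
    have hlim' := (tendsto_rpow_mul_shift hlim x).const_mul (Real.exp (2 * x) / m)
    have hlt : Real.exp (2 * x) / m * L < b := by
      refine lt_of_le_of_lt ?_ hxb
      gcongr
    filter_upwards [hlim'.eventually_lt_const hlt, eventually_ge_atTop 0] with w hw hw0
    refine lt_of_le_of_lt ?_ hw
    have h1 := hK.le_integral_of_exp_mul_monotone hB0 hmono hw0 (hi (w + x))
    have h2 : B w ≤ Real.exp (2 * x) / m * ∫ u in Ioi (0 : ℝ), B u * K (u - (w + x)) := by
      rw [Real.exp_neg] at h1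
      rw [div_mul_eq_mul_div, le_div_iff₀ hm0]
      have := mul_le_mul_of_nonneg_left h1 (Real.exp_pos (2 * x)).le
      rw [← mul_assoc, ← mul_assoc, mul_inv_cancel₀ (Real.exp_pos _).ne'] at this
      linarith
    calc w ^ (1 - α) * B w
        ≤ w ^ (1 - α) * (Real.exp (2 * x) / m * ∫ u in Ioi (0 : ℝ), B u * K (u - (w + x))) :=
          mul_le_mul_of_nonneg_left h2 (Real.rpow_nonneg hw0 _)
      _ = _ := by ring
  obtain ⟨w₀, hw₀⟩ := eventually_atTop.mp
    ((hupper (L + 1) (by linarith)).and (eventually_ge_atTop 1))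
  have hw₀1 : 1 ≤ w₀ := (hw₀ w₀ le_rfl).2
  set M := L + 1
  set β := min (α / 2) 1
  have hβ0 : 0 < β := lt_min (by linarith) one_pos
  have hβ1 : β ≤ 1 := min_le_right _ _
  have hβα : β < α := lt_of_le_of_lt (min_le_left _ _) (by linarith)
  obtain ⟨E, hE0, hP⟩ : ∃ E, 0 ≤ E ∧ ∀ u, 0 < u → B u ≤ M * u ^ (α - 1) + E * u ^ (β - 1) := by
    have hc : 0 < w₀ ^ (β - 1) := Real.rpow_pos_of_pos (by linarith) _
    refine ⟨Real.exp w₀ * B w₀ / w₀ ^ (β - 1), div_nonneg (mul_nonneg (Real.exp_pos _).le (hB0 _))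
      hc.le, fun u hu => ?_⟩
    have hM0 : 0 ≤ M * u ^ (α - 1) := mul_nonneg (by linarith) (Real.rpow_nonneg hu.le _)
    have hE0 : 0 ≤ Real.exp w₀ * B w₀ / w₀ ^ (β - 1) * u ^ (β - 1) :=
      mul_nonneg (div_nonneg (mul_nonneg (Real.exp_pos _).le (hB0 _)) hc.le)
        (Real.rpow_nonneg hu.le _)
    rcases le_total w₀ u with huw | huw
    · have h1 := (hw₀ u huw).1
      have h2 : B u ≤ M * u ^ (α - 1) := by
        rw [← neg_sub, Real.rpow_neg hu.le, inv_mul_lt_iff₀ (Real.rpow_pos_of_pos hu _)] at h1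
        linarith
      linarith
    · have h1 := le_exp_mul_of_exp_mul_monotone hmono huw
      have h2 : Real.exp (w₀ - u) * B w₀ ≤ Real.exp w₀ * B w₀ :=
        mul_le_mul_of_nonneg_right (Real.exp_le_exp.mpr (by linarith)) (hB0 _)
      have h3 : w₀ ^ (β - 1) ≤ u ^ (β - 1) :=
        Real.rpow_le_rpow_of_nonpos hu huw (by linarith)
      have h4 : Real.exp w₀ * B w₀ ≤ Real.exp w₀ * B w₀ / w₀ ^ (β - 1) * u ^ (β - 1) := by
        rw [div_mul_eq_mul_div, le_div_iff₀ hc]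
        exact mul_le_mul_of_nonneg_left h3 (mul_nonneg (Real.exp_pos _).le (hB0 _))
      linarith
  have hlower : ∀ a, a < L → ∀ᶠ w in atTop, a < w ^ (1 - α) * B w := by
    intro a ha
    have hx : Tendsto (fun x : ℝ => Real.exp (-(2 * x)) * (L - M * x)) (𝓝[>] 0) (𝓝 L) := by
      have hc : ContinuousAt (fun x : ℝ => Real.exp (-(2 * x)) * (L - M * x)) 0 := by fun_prop
      have := hc.tendsto
      simp only [mul_zero, neg_zero, Real.exp_zero, sub_zero, one_mul] at this
      exact this.mono_left nhdsWithin_le_nhds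
    obtain ⟨x, hxa, hx0, hx1⟩ := ((hx.eventually_const_lt ha).and
      (Ioo_mem_nhdsGT (zero_lt_one' ℝ))).exists
    obtain ⟨K, φ, hK, hm⟩ :=
      exists_isBandLimitedKernel_concentrated hx0 (show 1 - x < 1 by linarith)
    obtain ⟨hi, hlim⟩ := hT K φ hK
    set K' := (Ioc (-x) x)ᶜ.indicator K with hK'
    have hK'm : Measurable K' := hK.continuous.measurable.indicator measurableSet_Ioc.compl
    have hK'd : ∀ n : ℕ, ∃ C, ∀ y, (1 + |y|) ^ n * |K' y| ≤ C := by
      intro n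
      obtain ⟨C, hC⟩ := hK.decay n
      refine ⟨C, fun y => le_trans ?_ (hC y)⟩
      refine mul_le_mul_of_nonneg_left ?_ (by positivity)
      exact norm_indicator_le_norm_self K y
    have hK'i : ∫ y, K' y = 1 - ∫ y in Ioc (-x) x, K y := by
      rw [hK', integral_indicator measurableSet_Ioc.compl, ← hK.integral_eq_one,
        ← integral_add_compl measurableSet_Ioc hK.integrable, add_sub_cancel_left]
    have hIα := tendsto_rpow_mul_integral_kernel hα hK'm hK'd
    have hIβ := tendsto_rpow_mul_integral_kernel_of_lt hβ0 hβα hK'm hK'd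
    have hcomb := ((hlim.sub (hIα.const_mul M)).sub (hIβ.const_mul E)).const_mul
      (Real.exp (-(2 * x)))
    rw [hK'i, mul_zero, sub_zero] at hcomb
    have hshift := tendsto_rpow_mul_shift (γ := 1 - α) (Y := fun v => Real.exp (-(2 * x)) *
      ((∫ u in Ioi (0 : ℝ), B u * K (u - v)) - M * (∫ u in Ioi (0 : ℝ), u ^ (α - 1) * K' (u - v))
        - E * ∫ u in Ioi (0 : ℝ), u ^ (β - 1) * K' (u - v)))
      (hcomb.congr fun v => by ring) (-x)
    have hlt : a < Real.exp (-(2 * x)) * (L - M * (1 - ∫ y in Ioc (-x) x, K y)) := by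
      refine hxa.trans_le ?_
      refine mul_le_mul_of_nonneg_left ?_ (Real.exp_pos _).le
      have : M * (1 - ∫ y in Ioc (-x) x, K y) ≤ M * x :=
        mul_le_mul_of_nonneg_left (by linarith) (by linarith)
      linarith
    filter_upwards [hshift.eventually_const_lt hlt, eventually_ge_atTop 2] with w hw hw2
    refine hw.trans_le ?_
    refine mul_le_mul_of_nonneg_left ?_ (Real.rpow_nonneg (by linarith) _)
    have hiα := (integrableOn_rpow_mul_kernel hα hK'm hK'd (w + -x)).const_mul M
    have hiβ := (integrableOn_rpow_mul_kernel hβ0 hK'm hK'd (w + -x)).const_mul E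
    have hPi : IntegrableOn (fun u => (M * u ^ (α - 1) + E * u ^ (β - 1)) * K' (u - (w + -x)))
        (Ioi 0) := by
      refine (hiα.add hiβ).congr (ae_of_all _ fun u => ?_)
      simp only [Pi.add_apply]
      ring
    have h1 := hK.integral_le_of_exp_mul_monotone hB0 hmono hP (by linarith) (hi (w + -x)) hPi
    have h2 : ∫ u in Ioi (0 : ℝ), (M * u ^ (α - 1) + E * u ^ (β - 1)) * K' (u - (w + -x))
        = M * (∫ u in Ioi (0 : ℝ), u ^ (α - 1) * K' (u - (w + -x)))
          + E * ∫ u in Ioi (0 : ℝ), u ^ (β - 1) * K' (u - (w + -x)) := by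
      rw [← integral_const_mul, ← integral_const_mul, ← integral_add hiα hiβ]
      refine integral_congr_ae (ae_of_all _ fun u => ?_)
      simp only
      ring
    rw [← hK', h2, neg_add_cancel_right] at h1
    rw [Real.exp_neg, inv_mul_le_iff₀ (Real.exp_pos _)]
    linarith
  exact tendsto_order.mpr ⟨hlower, hupper⟩

end Tauberian

theorem integrableOn_const_mul_rpow_mul_cexp_neg_mul {β : ℝ} (hβ : 0 < β) {z : ℂ} (hz : 0 < z.re)
    (a : ℂ) :
    IntegrableOn (fun u : ℝ => a * ((u ^ (β - 1) : ℝ) : ℂ) * Complex.exp (-z * u)) (Ioi 0) := by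
  have h := (integrableOn_rpow_mul_exp_neg_mul hβ hz).ofReal.const_mul a
  refine Integrable.mono h ?_ (ae_of_all _ fun u => le_of_eq ?_)
  · have : Measurable fun u : ℝ => a * ((u ^ (β - 1) : ℝ) : ℂ) * Complex.exp (-z * u) := by
      fun_prop
    exact this.aestronglyMeasurable
  · simp [Complex.norm_exp, mul_assoc, -Complex.ofReal_exp]

section PowerSum

variable {ι : Type*} [Fintype ι] {γ : ι → ℝ} (c : ι → ℂ)

theorem integrableOn_sum_rpow_mul_exp_neg_mul (hγ : ∀ j, 0 < γ j) {δ : ℝ} (hδ : 0 < δ) :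
    IntegrableOn (fun u : ℝ => (∑ j, c j * ((u ^ (γ j - 1) : ℝ) : ℂ)) * Real.exp (-(δ * u)))
      (Ioi 0) := by
  simp_rw [Finset.sum_mul]
  refine integrable_finsetSum _ fun j _ => ?_
  refine ((integrableOn_rpow_mul_exp_neg_mul (hγ j) hδ).ofReal.const_mul (c j)).congr
    (ae_of_all _ fun u => ?_)
  simp only [RCLike.ofReal_mul, coe_algebraMap]
  ring_nf

theorem integral_sum_rpow_mul_cexp_neg_mul (hγ : ∀ j, 0 < γ j) {z : ℂ} (hz : 0 < z.re) :
    ∫ u in Ioi (0 : ℝ), (∑ j, c j * ((u ^ (γ j - 1) : ℝ) : ℂ)) * Complex.exp (-z * u)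
      = ∑ j, c j * Real.Gamma (γ j) / z ^ (γ j : ℂ) := by
  simp_rw [Finset.sum_mul]
  rw [integral_finsetSum _ fun j _ =>
    integrableOn_const_mul_rpow_mul_cexp_neg_mul (hγ j) hz (c j)]
  refine Finset.sum_congr rfl fun j _ => ?_
  simp_rw [mul_assoc]
  rw [integral_const_mul, integral_rpow_mul_cexp_neg_mul (hγ j) hz, mul_div_assoc]

variable {K : ℝ → ℝ}

theorem integrableOn_sum_rpow_mul_kernel (hγ : ∀ j, 0 < γ j) (hK : Measurable K)
    (hdec : ∀ n : ℕ, ∃ C, ∀ x, (1 + |x|) ^ n * |K x| ≤ C) (v : ℝ) :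
    IntegrableOn (fun u : ℝ => (∑ j, c j * ((u ^ (γ j - 1) : ℝ) : ℂ)) * K (u - v)) (Ioi 0) := by
  simp_rw [Finset.sum_mul]
  refine integrable_finsetSum _ fun j _ => ?_
  refine ((integrableOn_rpow_mul_kernel (hγ j) hK hdec v).ofReal.const_mul (c j)).congr
    (ae_of_all _ fun u => ?_)
  simp [mul_assoc]

theorem integral_sum_rpow_mul_kernel (hγ : ∀ j, 0 < γ j) (hK : Measurable K)
    (hdec : ∀ n : ℕ, ∃ C, ∀ x, (1 + |x|) ^ n * |K x| ≤ C) (v : ℝ) :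
    ∫ u in Ioi (0 : ℝ), (∑ j, c j * ((u ^ (γ j - 1) : ℝ) : ℂ)) * K (u - v)
      = ∑ j, c j * ((∫ u in Ioi (0 : ℝ), u ^ (γ j - 1) * K (u - v) : ℝ) : ℂ) := by
  simp_rw [Finset.sum_mul]
  rw [integral_finsetSum _ fun j _ => ?_]
  · refine Finset.sum_congr rfl fun j _ => ?_
    rw [← integral_complex_ofReal, ← integral_const_mul]
    simp [mul_assoc]
  · refine ((integrableOn_rpow_mul_kernel (hγ j) hK hdec v).ofReal.const_mul (c j)).congr
      (ae_of_all _ fun u => ?_)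
    simp [mul_assoc]

end PowerSum

/-- Kable-type extension of the Wiener–Ikehara theorem (Theorem 1 of the paper). -/
theorem wiener_ikehara_kable_extension
    (f : ℝ → ℝ) (hf_nonneg : ∀ u, 0 ≤ f u) (hf_mono : Monotone f)
    (hF_conv : ∀ s : ℂ, 1 < s.re →
      IntegrableOn (fun u : ℝ => (f u : ℂ) * Complex.exp (-s * u)) (Ioi 0))
    (F : ℂ → ℂ)
    (hF : ∀ s : ℂ, 1 < s.re →
      F s = ∫ u in Ioi (0 : ℝ), (f u : ℂ) * Complex.exp (-s * u))
    (r : ℕ) (α : ℝ) (hα : 0 < α) (A : ℝ) (hA : 0 < A)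
    (αi : Fin r → ℝ) (Ai : Fin r → ℂ)
    (hαi_pos : ∀ i, 0 < αi i) (hαi_lt : ∀ i, αi i < α)
    (G : ℂ → ℂ)
    (hG : ∀ s : ℂ, 1 < s.re →
      G s = F s - (A : ℂ) / (s - 1) ^ (α : ℂ)
        - ∑ i, Ai i / (s - 1) ^ ((αi i : ℝ) : ℂ))
    (hG_cont : ContinuousOn G {s : ℂ | 1 ≤ s.re})
    (hBV : α < 1 → ∀ a b : ℝ,
      BoundedVariationOn (fun t : ℝ => G (1 + t * Complex.I)) (Icc a b)) :
    Tendsto (fun u : ℝ => u ^ (1 - α) * Real.exp (-u) * f u) atTop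
      (𝓝 (A / Real.Gamma α)) := by
  have hΓ : ∀ {β : ℝ}, 0 < β → (Real.Gamma β : ℂ) ≠ 0 := fun hβ =>
    Complex.ofReal_ne_zero.mpr (Real.Gamma_pos_of_pos hβ).ne'
  set B : ℝ → ℝ := fun u => Real.exp (-u) * f u with hB
  have hBz : ∀ (z : ℂ) (u : ℝ),
      (B u : ℂ) * Complex.exp (-z * u) = f u * Complex.exp (-(1 + z) * u) := by
    intro z u
    rw [hB, show -(1 + z) * (u : ℂ) = -u + -z * u by ring, Complex.exp_add]
    push_cast
    ring
  have hBzi : ∀ z : ℂ, 0 < z.re →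
      IntegrableOn (fun u : ℝ => (B u : ℂ) * Complex.exp (-z * u)) (Ioi 0) := by
    intro z hz
    simp_rw [hBz]
    exact hF_conv _ (by simpa using hz)
  have hB0 : ∀ u, 0 ≤ B u := fun u => mul_nonneg (Real.exp_pos _).le (hf_nonneg u)
  have hBm : Measurable B := by
    have := hf_mono.measurable
    fun_prop
  have hmono : Monotone fun u => Real.exp u * B u := by
    have : (fun u => Real.exp u * B u) = f := by
      funext u
      rw [hB, ← mul_assoc, ← Real.exp_add, add_neg_cancel, Real.exp_zero, one_mul]
    rwa [this]
  have hBi : ∀ δ, 0 < δ → IntegrableOn (fun u => B u * Real.exp (-(δ * u))) (Ioi 0) := by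
    intro δ hδ
    refine (hBzi δ (by simpa using hδ)).re.congr (ae_of_all _ fun u => ?_)
    simp only [RCLike.re_to_complex, Complex.re_ofReal_mul]
    rw [show -(δ : ℂ) * u = ((-(δ * u) : ℝ) : ℂ) by push_cast; ring, Complex.exp_ofReal_re]
  set γ : Option (Fin r) → ℝ := fun j => j.elim α αi with hγd
  set c : Option (Fin r) → ℂ :=
    fun j => j.elim ((A / Real.Gamma α : ℝ) : ℂ) fun i => Ai i / Real.Gamma (αi i) with hcd
  have hγ : ∀ j, 0 < γ j := by rintro (_ | i) <;> simp [hγd, hα, hαi_pos]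
  set D : ℝ → ℂ := fun u => ∑ j, c j * ((u ^ (γ j - 1) : ℝ) : ℂ) with hD
  have hDz : ∀ z : ℂ, 0 < z.re →
      IntegrableOn (fun u : ℝ => D u * Complex.exp (-z * u)) (Ioi 0) := by
    intro z hz
    simp_rw [hD, Finset.sum_mul]
    exact integrable_finsetSum _ fun j _ =>
      integrableOn_const_mul_rpow_mul_cexp_neg_mul (hγ j) hz (c j)
  have hHc : ContinuousOn (fun z => G (1 + z)) {z : ℂ | 0 ≤ z.re} :=
    hG_cont.comp (by fun_prop) fun z hz => by simpa using hz
  have hH : ∀ z : ℂ, 0 < z.re →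
      G (1 + z) = ∫ u in Ioi (0 : ℝ), ((B u : ℂ) - D u) * Complex.exp (-z * u) := by
    intro z hz
    simp_rw [sub_mul]
    rw [integral_sub (hBzi z hz) (hDz z hz), integral_sum_rpow_mul_cexp_neg_mul c hγ hz,
      hG _ (by simpa using hz), hF _ (by simpa using hz), Fintype.sum_option, sub_sub]
    simp_rw [hBz, add_sub_cancel_left]
    congr 2
    · simp only [hcd, hγd, Option.elim_none]
      push_cast
      rw [div_mul_cancel₀ _ (hΓ hα)]
    · refine Finset.sum_congr rfl fun i _ => ?_
      simp only [hcd, hγd, Option.elim_some]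
      rw [div_mul_cancel₀ _ (hΓ (hαi_pos i))]
  have hg : Continuous fun t : ℝ => G (1 + t * I) :=
    continuousOn_univ.mp
      (hG_cont.comp (Continuous.continuousOn (by fun_prop)) fun t _ => by simp)
  have hmain : Tendsto (fun v : ℝ => v ^ (1 - α) * B v) atTop (𝓝 (A / Real.Gamma α)) := by
    refine tendsto_of_tendsto_kernel_averages hB0 hmono hα fun K φ hK => ?_
    have hKm := hK.continuous.measurable
    have hid := fun v => hK.boundary_identity hB0 hBm hBi
      (fun δ hδ => integrableOn_sum_rpow_mul_exp_neg_mul c hγ hδ)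
      (integrableOn_sum_rpow_mul_kernel c hγ hKm hK.decay v) hHc hH
    refine ⟨fun v => (hid v).1, ?_⟩
    have hosc : Tendsto (fun v : ℝ => ((v ^ (1 - α) : ℝ) : ℂ) *
        ∫ t : ℝ, φ t * G (1 + t * I) * Complex.exp (t * v * I)) atTop (𝓝 0) := by
      rw [tendsto_zero_iff_norm_tendsto_zero]
      refine (tendsto_rpow_mul_norm_oscillatory hK.compact_transform hK.lipschitz_transform hg hα
        hBV).congr' ?_
      filter_upwards [eventually_ge_atTop 0] with v hv
      rw [norm_mul, Complex.norm_real, Real.norm_of_nonneg (Real.rpow_nonneg hv _)]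
    have hpow : Tendsto (fun v : ℝ => ∑ j, c j * ((v ^ (1 - α) *
        ∫ u in Ioi (0 : ℝ), u ^ (γ j - 1) * K (u - v) : ℝ) : ℂ)) atTop
        (𝓝 ((A / Real.Gamma α : ℝ) : ℂ)) := by
      have hlim := tendsto_finsetSum (Finset.univ : Finset (Option (Fin r)))
        (f := fun j (v : ℝ) => c j * ((v ^ (1 - α) *
          ∫ u in Ioi (0 : ℝ), u ^ (γ j - 1) * K (u - v) : ℝ) : ℂ))
        (a := fun j => c j * ((j.elim 1 fun _ => 0 : ℝ) : ℂ)) (x := atTop) fun j _ => ?_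
      · simpa [Fintype.sum_option, hcd] using hlim
      · refine Tendsto.const_mul _ ((Complex.continuous_ofReal.tendsto _).comp ?_)
        rcases j with _ | i
        · simpa [hK.integral_eq_one, hγd] using tendsto_rpow_mul_integral_kernel hα hKm hK.decay
        · exact tendsto_rpow_mul_integral_kernel_of_lt (hαi_pos i) (hαi_lt i) hKm hK.decay
    have hre := (Complex.continuous_re.tendsto _).comp (hpow.add hosc)
    rw [add_zero, Complex.ofReal_re] at hre
    refine hre.congr fun v => ?_
    have hv : ((v ^ (1 - α) * ∫ u in Ioi (0 : ℝ), B u * K (u - v) : ℝ) : ℂ)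
        = (∑ j, c j * ((v ^ (1 - α) * ∫ u in Ioi (0 : ℝ), u ^ (γ j - 1) * K (u - v) : ℝ) : ℂ))
          + ((v ^ (1 - α) : ℝ) : ℂ) *
            ∫ t : ℝ, φ t * G (1 + t * I) * Complex.exp (t * v * I) := by
      rw [Complex.ofReal_mul, (hid v).2, integral_sum_rpow_mul_kernel c hγ hKm hK.decay, mul_add,
        Finset.mul_sum]
      congr 1
      refine Finset.sum_congr rfl fun j _ => ?_
      push_cast
      ring
    rw [Function.comp_apply, ← hv, Complex.ofReal_re]
  refine hmain.congr fun u => ?_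
  rw [hB]
  ring
end

section
/- Let {a_n} be a sequence of non-negative real numbers, d > 0, and m, l positive integers. Suppose L(s) = Σ_{n=1}^∞ a_n n^{-s} converges absolutely for Re(s) > d, and that the function Q(s) = L(s)^m (s − d)^l extends to a holomorphic function on an open disc D centered at s = d with Q(d) = A^m for some real A > 0. Then the function s ↦ L(s)(s − d)^{l/m} (principal branch power), defined on {Re(s) > d} ∩ D, extends to a holomorphic function on a neighborhood of s = d, and lim_{s → d, Re(s) > d} L(s)(s − d)^{l/m} = A. -/
open MeasureTheory Set Filter Complex Topology

/-- Two continuous functions on a preconnected set with equal `m`-th powers, one of them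
non-vanishing, agree everywhere as soon as they agree at one point. -/
lemma IsPreconnected.eqOn_of_pow_eq {X : Type*} [TopologicalSpace X] {S : Set X}
    (hS : IsPreconnected S) {f g : X → ℂ} (hf : ContinuousOn f S) (hg : ContinuousOn g S)
    (hg0 : ∀ x ∈ S, g x ≠ 0) {m : ℕ} (hm : 0 < m) (hfg : ∀ x ∈ S, f x ^ m = g x ^ m)
    {x₀ : X} (hx₀ : x₀ ∈ S) (h₀ : f x₀ = g x₀) : EqOn f g S := by
  intro x hx
  have hfin : {z : ℂ | z ^ m = 1}.Finite := by
    refine ((Polynomial.nthRoots m (1 : ℂ)).toFinset.finite_toSet).subset fun z hz ↦ ?_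
    simpa [Polynomial.mem_nthRoots hm] using hz
  have hmaps : MapsTo (fun y ↦ f y / g y) S {z : ℂ | z ^ m = 1} := fun y hy ↦ by
    simp only [mem_ofPred_eq, div_pow, hfg y hy]
    exact div_self (pow_ne_zero _ (hg0 y hy))
  have hconst : f x / g x = f x₀ / g x₀ :=
    hS.constant_of_mapsTo hfin.isDiscrete (hf.div hg hg0) hmaps hx hx₀
  rw [h₀, div_self (hg0 x₀ hx₀), div_eq_one_iff_eq (hg0 x hx)] at hconst
  exact hconst

/-- The sum of an absolutely convergent Dirichlet series is continuous on an open half-plane of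
absolute convergence. -/
lemma continuousOn_of_dirichletSeries {a : ℕ → ℂ} {d : ℝ} {L : ℂ → ℂ}
    (hsum : ∀ s : ℂ, d < s.re → Summable fun n : ℕ ↦ ‖a (n + 1) / ((n + 1 : ℕ) : ℂ) ^ s‖)
    (hL : ∀ s : ℂ, d < s.re → L s = ∑' n : ℕ, a (n + 1) / ((n + 1 : ℕ) : ℂ) ^ s) :
    ContinuousOn L {s : ℂ | d < s.re} := by
  have hterm (s : ℂ) (n : ℕ) :
      LSeries.term a s (n + 1) = a (n + 1) / ((n + 1 : ℕ) : ℂ) ^ s :=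
    LSeries.term_of_ne_zero n.succ_ne_zero a s
  have hsummable (s : ℂ) (hs : d < s.re) : LSeriesSummable a s := by
    refine (summable_nat_add_iff 1).mp ?_
    simpa only [hterm] using (hsum s hs).of_norm
  have habs : LSeries.abscissaOfAbsConv a ≤ d :=
    LSeries.abscissaOfAbsConv_le_of_forall_lt_LSeriesSummable fun y hy ↦ hsummable y (by simpa)
  refine ((LSeries_differentiableOn a).continuousOn.mono fun s hs ↦ ?_).congr fun s hs ↦ ?_
  · exact habs.trans_lt (EReal.coe_lt_coe_iff.mpr hs)
  · rw [hL s hs, LSeries, (hsummable s hs).tsum_eq_zero_add, LSeries.term_zero, zero_add]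
    simp only [hterm]

/-- A Dirichlet series with non-negative coefficients takes non-negative values at real points. -/
lemma tsum_dirichlet_ofReal_nonneg {a : ℕ → ℝ} (ha : ∀ n, 0 ≤ a n) (x : ℝ) :
    ∃ r : ℝ, 0 ≤ r ∧
      ∑' n : ℕ, (a (n + 1) : ℂ) / ((n + 1 : ℕ) : ℂ) ^ (x : ℂ) = r := by
  refine ⟨∑' n : ℕ, a (n + 1) / ((n + 1 : ℕ) : ℝ) ^ x,
    tsum_nonneg fun n ↦ div_nonneg (ha _) (by positivity), ?_⟩
  rw [ofReal_tsum]
  refine tsum_congr fun n ↦ ?_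
  rw [ofReal_div, ofReal_cpow (by positivity), ofReal_natCast]

/-- If `L(s)^m (s-d)^l` extends holomorphically near `s = d` with value `A^m` there,
then `L(s)(s-d)^{l/m}` extends holomorphically near `s = d` and tends to `A`. -/
theorem root_of_pole_extension
    (a : ℕ → ℝ) (ha : ∀ n, 0 ≤ a n)
    (d : ℝ) (hd : 0 < d) (m l : ℕ) (hm : 0 < m) (hl : 0 < l)
    (L : ℂ → ℂ)
    (hL_conv : ∀ s : ℂ, d < s.re →
      Summable (fun n : ℕ => ‖(a (n + 1) : ℂ) / ((n + 1 : ℕ) : ℂ) ^ s‖))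
    (hL : ∀ s : ℂ, d < s.re →
      L s = ∑' n : ℕ, (a (n + 1) : ℂ) / ((n + 1 : ℕ) : ℂ) ^ s)
    (ε : ℝ) (hε : 0 < ε) (Q : ℂ → ℂ)
    (hQ_hol : DifferentiableOn ℂ Q (Metric.ball (d : ℂ) ε))
    (hQ_eq : ∀ s ∈ Metric.ball (d : ℂ) ε, d < s.re →
      Q s = (L s) ^ m * (s - (d : ℂ)) ^ l)
    (A : ℝ) (hA : 0 < A) (hQd : Q (d : ℂ) = (A : ℂ) ^ m) :
    (∃ δ : ℝ, 0 < δ ∧ ∃ g : ℂ → ℂ,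
        DifferentiableOn ℂ g (Metric.ball (d : ℂ) δ) ∧
        (∀ s ∈ Metric.ball (d : ℂ) δ, d < s.re →
          g s = L s * (s - (d : ℂ)) ^ ((l : ℂ) / (m : ℂ))) ∧
        g (d : ℂ) = (A : ℂ)) ∧
      Tendsto (fun s : ℂ => L s * (s - (d : ℂ)) ^ ((l : ℂ) / (m : ℂ)))
        (𝓝[{s : ℂ | d < s.re}] (d : ℂ)) (𝓝 (A : ℂ)) := by
  have hm0 : (m : ℂ) ≠ 0 := Nat.cast_ne_zero.mpr hm.ne'
  have hAm : (A : ℂ) ^ m ≠ 0 := pow_ne_zero _ (ofReal_ne_zero.mpr hA.ne')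
  have hQd' : Q d / (A : ℂ) ^ m ∈ slitPlane := by
    rw [hQd, div_self hAm]; exact one_mem_slitPlane
  have hQcont : ContinuousAt (fun s ↦ Q s / (A : ℂ) ^ m) (d : ℂ) :=
    (hQ_hol.continuousOn.continuousAt (Metric.ball_mem_nhds _ hε)).div_const _
  obtain ⟨δ, hδ, hball⟩ := Metric.mem_nhds_iff.mp
    (inter_mem (hQcont.preimage_mem_nhds (isOpen_slitPlane.mem_nhds hQd'))
      (Metric.ball_mem_nhds (d : ℂ) hε))
  set g : ℂ → ℂ := fun s ↦ A * (Q s / (A : ℂ) ^ m) ^ ((m : ℂ)⁻¹) with hg_def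
  have hg_diff : DifferentiableOn ℂ g (Metric.ball (d : ℂ) δ) :=
    (((hQ_hol.mono fun s hs ↦ (hball hs).2).div_const _).cpow_const
      fun s hs ↦ (hball hs).1).const_mul _
  have hg_d : g d = A := by simp [hg_def, hQd, div_self hAm]
  have hg_pow (s : ℂ) : g s ^ m = Q s := by
    simp only [hg_def, mul_pow, cpow_nat_inv_pow _ hm.ne']
    exact mul_div_cancel₀ _ hAm
  have hg_ne (s : ℂ) (hs : s ∈ Metric.ball (d : ℂ) δ) : g s ≠ 0 := fun h ↦ by
    have hQ0 : Q s = 0 := by rw [← hg_pow, h, zero_pow hm.ne']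
    exact slitPlane_ne_zero (hball hs).1 (by simp [hQ0])
  set S : Set ℂ := Metric.ball (d : ℂ) δ ∩ {s | d < s.re}
  have hS : IsPreconnected S :=
    ((convex_ball _ _).inter (convex_halfSpace_re_gt d)).isPreconnected
  set f : ℂ → ℂ := fun s ↦ L s * (s - (d : ℂ)) ^ ((l : ℂ) / (m : ℂ)) with hf_def
  have hf_cont : ContinuousOn f S := by
    refine ((continuousOn_of_dirichletSeries (a := fun n ↦ (a n : ℂ)) hL_conv hL).mono
      inter_subset_right).mul ?_
    refine (continuousOn_id.sub continuousOn_const).cpow_const fun s hs ↦ Or.inl ?_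
    simpa using hs.2
  have hf_pow (s : ℂ) (hs : s ∈ S) : f s ^ m = g s ^ m := by
    rw [hg_pow, hQ_eq s (hball hs.1).2 hs.2, hf_def, mul_pow, ← cpow_mul_nat,
      div_mul_cancel₀ _ hm0, cpow_natCast]
  set x : ℝ := d + δ / 2 with hx_def
  have hxS : (x : ℂ) ∈ S := by
    refine ⟨?_, ?_⟩
    · rw [Metric.mem_ball, dist_eq, ← ofReal_sub, norm_real, Real.norm_eq_abs, hx_def,
        add_sub_cancel_left, abs_of_pos (half_pos hδ)]
      exact half_lt_self hδ
    · simp [hx_def, hδ]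
  have hfg_x : f x = g x := by
    obtain ⟨r, hr, hLr⟩ := tsum_dirichlet_ofReal_nonneg ha x
    rw [← hL x hxS.2] at hLr
    have hsub : (0 : ℝ) ≤ x - d := by rw [hx_def]; linarith
    have hf_real : f x = ((r * (x - d) ^ ((l : ℝ) / m) : ℝ) : ℂ) := by
      rw [hf_def]
      simp only [hLr]
      push_cast [ofReal_cpow hsub]
      rfl
    have hg_real : g x = ((A * (r ^ m * (x - d) ^ l / A ^ m) ^ ((m : ℝ)⁻¹) : ℝ) : ℂ) := by
      have hnn : 0 ≤ r ^ m * (x - d) ^ l / A ^ m := by positivity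
      rw [hg_def]
      simp only [hQ_eq x (hball hxS.1).2 hxS.2, hLr]
      push_cast [ofReal_cpow hnn]
      rfl
    have hpow := hf_pow x hxS
    rw [hf_real, hg_real] at hpow ⊢
    norm_cast at hpow ⊢
    exact (pow_left_inj₀ (by positivity) (by positivity) hm.ne').mp hpow
  have hfg : EqOn f g S := hS.eqOn_of_pow_eq hf_cont
    (hg_diff.continuousOn.mono inter_subset_left) (fun s hs ↦ hg_ne s hs.1) hm hf_pow hxS hfg_x
  refine ⟨⟨δ, hδ, g, hg_diff, fun s hs hs' ↦ (hfg ⟨hs, hs'⟩).symm, hg_d⟩, ?_⟩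
  have hg_tendsto : Tendsto g (𝓝[{s : ℂ | d < s.re}] (d : ℂ)) (𝓝 (A : ℂ)) := by
    have := hg_diff.continuousOn.continuousAt (Metric.ball_mem_nhds _ hδ)
    rw [ContinuousAt, hg_d] at this
    exact this.mono_left nhdsWithin_le_nhds
  refine hg_tendsto.congr' ?_
  filter_upwards [self_mem_nhdsWithin,
    mem_nhdsWithin_of_mem_nhds (Metric.ball_mem_nhds (d : ℂ) hδ)] with s hs hs'
  exact (hfg ⟨hs', hs⟩).symm
end

section
/- Let {a_n} be a sequence of non-negative real numbers and d > 0, and suppose L(s) = Σ_{n=1}^∞ a_n n^{-s} converges absolutely for Re(s) > d. Define f : ℝ → [0,∞) by f(u) = Σ_{n=1}^∞ a_n · 1_{[d log n, ∞)}(u). Then for all s with Re(s) > 1, the Laplace transform satisfies ∫₀^∞ f(u) e^{-su} du = (1/s) L(ds). -/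
open MeasureTheory Set Filter Complex Topology

/-- On `(0, ∞)`, the indicator of `[c, ∞)` may be replaced by restricting to `(c, ∞)`. -/
lemma restrict_Ioi_zero_restrict_Ici {c : ℝ} (hc : 0 ≤ c) :
    (volume.restrict (Ioi (0 : ℝ))).restrict (Ici c) = volume.restrict (Ioi c) := by
  rw [restrict_Ioi_eq_restrict_Ici, Measure.restrict_restrict measurableSet_Ici,
    inter_eq_left.mpr (Ici_subset_Ici.mpr hc), restrict_Ioi_eq_restrict_Ici]

lemma indicator_mul_exp_eq (b c : ℝ) (s : ℂ) :
    (fun u : ℝ => (((Ici c).indicator (fun _ => b) u : ℝ) : ℂ) * Complex.exp (-s * u)) =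
      (Ici c).indicator fun u : ℝ => (b : ℂ) * Complex.exp (-s * u) := by
  ext u
  by_cases hu : u ∈ Ici c <;> simp [hu]

lemma integrable_indicator_mul_exp (b : ℝ) {c : ℝ} (hc : 0 ≤ c) {s : ℂ} (hs : 0 < s.re) :
    Integrable (fun u : ℝ => (((Ici c).indicator (fun _ => b) u : ℝ) : ℂ) * Complex.exp (-s * u))
      (volume.restrict (Ioi 0)) := by
  rw [indicator_mul_exp_eq, integrable_indicator_iff measurableSet_Ici, IntegrableOn,
    restrict_Ioi_zero_restrict_Ici hc]
  exact (integrableOn_exp_mul_complex_Ioi (by simpa using hs) c).const_mul _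

lemma integral_indicator_mul_exp (b : ℝ) {c : ℝ} (hc : 0 ≤ c) {s : ℂ} (hs : 0 < s.re) :
    ∫ u in Ioi (0 : ℝ), (((Ici c).indicator (fun _ => b) u : ℝ) : ℂ) * Complex.exp (-s * u) =
      (1 / s) * (b * Complex.exp (-s * c)) := by
  rw [indicator_mul_exp_eq, integral_indicator measurableSet_Ici,
    restrict_Ioi_zero_restrict_Ici hc, integral_const_mul,
    integral_exp_mul_complex_Ioi (by simpa using hs)]
  rw [neg_div_neg_eq]
  ring

lemma integral_norm_indicator_mul_exp {b : ℝ} (hb : 0 ≤ b) {c : ℝ} (hc : 0 ≤ c) {s : ℂ}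
    (hs : 0 < s.re) :
    ∫ u in Ioi (0 : ℝ), ‖(((Ici c).indicator (fun _ => b) u : ℝ) : ℂ) * Complex.exp (-s * u)‖ =
      (1 / s.re) * ‖(b : ℂ) * Complex.exp (-s * c)‖ := by
  have key := integral_indicator_mul_exp b hc (s := (s.re : ℂ)) (by simpa using hs)
  have hnorm (x u : ℝ) (hx : 0 ≤ x) : ((‖(x : ℂ) * Complex.exp (-s * u)‖ : ℝ) : ℂ) =
      x * Complex.exp (-(s.re : ℂ) * u) := by
    simp [Complex.norm_exp, abs_of_nonneg hx]
  apply Complex.ofReal_injective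
  rw [← integral_complex_ofReal]
  simp_rw [hnorm _ _ (indicator_nonneg (fun _ _ => hb) _)]
  rw [key, Complex.ofReal_mul, hnorm _ _ hb]
  simp

lemma natCast_cpow_mul_eq_exp {n : ℕ} (hn : n ≠ 0) (d : ℝ) (s : ℂ) (b : ℂ) :
    b / (n : ℂ) ^ ((d : ℂ) * s) = b * Complex.exp (-s * (d * Real.log n : ℝ)) := by
  rw [Complex.cpow_def_of_ne_zero (by exact_mod_cast hn), div_eq_mul_inv, ← Complex.exp_neg,
    ← Complex.natCast_log]
  push_cast
  ring_nf

/-- The Laplace transform of `f(u) = Σ aₙ 1_{[d log n, ∞)}(u)` is `(1/s) L(ds)`. -/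
theorem laplace_transform_of_summatory_function
    (a : ℕ → ℝ) (ha : ∀ n, 0 ≤ a n) (d : ℝ) (hd : 0 < d)
    (L : ℂ → ℂ)
    (hL_conv : ∀ s : ℂ, d < s.re →
      Summable (fun n : ℕ => ‖(a (n + 1) : ℂ) / ((n + 1 : ℕ) : ℂ) ^ s‖))
    (hL : ∀ s : ℂ, d < s.re →
      L s = ∑' n : ℕ, (a (n + 1) : ℂ) / ((n + 1 : ℕ) : ℂ) ^ s)
    (f : ℝ → ℝ)
    (hf : ∀ u : ℝ, f u = ∑' n : ℕ,
      Set.indicator (Set.Ici (d * Real.log ((n + 1 : ℕ) : ℝ))) (fun _ => a (n + 1)) u) :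
    ∀ s : ℂ, 1 < s.re →
      ∫ u in Ioi (0 : ℝ), (f u : ℂ) * Complex.exp (-s * u) = (1 / s) * L (d * s) := by
  intro s hs
  have hs₀ : 0 < s.re := zero_lt_one.trans hs
  have hds : d < ((d : ℂ) * s).re := by
    simpa using (lt_mul_iff_one_lt_right hd).mpr hs
  have hc (n : ℕ) : 0 ≤ d * Real.log ((n + 1 : ℕ) : ℝ) :=
    mul_nonneg hd.le (Real.log_natCast_nonneg _)
  have hconv := hL_conv _ hds
  simp_rw [natCast_cpow_mul_eq_exp (Nat.add_one_ne_zero _)] at hconv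
  rw [hL _ hds]
  simp_rw [natCast_cpow_mul_eq_exp (Nat.add_one_ne_zero _), hf, Complex.ofReal_tsum,
    ← tsum_mul_right]
  rw [← integral_tsum_of_summable_integral_norm
    (fun n => integrable_indicator_mul_exp (a (n + 1)) (hc n) hs₀), ← tsum_mul_left]
  · exact tsum_congr fun n => integral_indicator_mul_exp _ (hc n) hs₀
  · simp_rw [integral_norm_indicator_mul_exp (ha _) (hc _) hs₀]
    exact hconv.mul_left _
end

section
/- For every prime p and every s with Re(s) > 1/2, one has 1 − (5/3) p^{-2s} + (10/27) p^{-3s} + (20/27) p^{-4s} − (8/27) p^{-5s} = (1 + p^{-s})² (1 − (2/3) p^{-s})³ ≠ 0. Consequently the holomorphic function F(s) = Π_{p prime} (1 − (5/3) p^{-2s} + (10/27) p^{-3s} + (20/27) p^{-4s} − (8/27) p^{-5s}) is nowhere zero on Re(s) > 1/2, so F(s)^{-1} is holomorphic on Re(s) > 1/2. -/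
open MeasureTheory Set Filter Complex Topology

/-- The Euler factor `1 − (5/3)p^{-2s} + (10/27)p^{-3s} + (20/27)p^{-4s} − (8/27)p^{-5s}`. -/
noncomputable def eulerFactorF (p : ℕ) (s : ℂ) : ℂ :=
  1 - (5 / 3 : ℂ) * (p : ℂ) ^ (-2 * s) + (10 / 27 : ℂ) * (p : ℂ) ^ (-3 * s)
    + (20 / 27 : ℂ) * (p : ℂ) ^ (-4 * s) - (8 / 27 : ℂ) * (p : ℂ) ^ (-5 * s)

theorem eulerFactorF_eq_pow (p : ℕ) (s : ℂ) :
    eulerFactorF p s = 1 - (5 / 3 : ℂ) * ((p : ℂ) ^ (-s)) ^ 2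
      + (10 / 27 : ℂ) * ((p : ℂ) ^ (-s)) ^ 3 + (20 / 27 : ℂ) * ((p : ℂ) ^ (-s)) ^ 4
      - (8 / 27 : ℂ) * ((p : ℂ) ^ (-s)) ^ 5 := by
  simp only [eulerFactorF, ← cpow_nat_mul]
  push_cast
  ring_nf

theorem eulerFactorF_factorization (p : ℕ) (s : ℂ) :
    eulerFactorF p s
      = (1 + (p : ℂ) ^ (-s)) ^ 2 * (1 - (2 / 3 : ℂ) * (p : ℂ) ^ (-s)) ^ 3 := by
  rw [eulerFactorF_eq_pow]
  ring

theorem Nat.Prime.norm_cpow_neg_lt_one {p : ℕ} (hp : p.Prime) {s : ℂ} (hs : 0 < s.re) :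
    ‖(p : ℂ) ^ (-s)‖ < 1 := by
  rw [norm_natCast_cpow_of_pos hp.pos, neg_re]
  exact Real.rpow_lt_one_of_one_lt_of_neg (mod_cast hp.one_lt) (neg_lt_zero.2 hs)

theorem eulerFactorF_ne_zero {p : ℕ} (hp : p.Prime) {s : ℂ} (hs : 0 < s.re) :
    eulerFactorF p s ≠ 0 := by
  have hx := hp.norm_cpow_neg_lt_one hs
  rw [eulerFactorF_factorization]
  refine mul_ne_zero (pow_ne_zero 2 fun h => ?_) (pow_ne_zero 3 fun h => ?_)
  · rw [eq_neg_of_add_eq_zero_right h] at hx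
    simp at hx
  · have h' : (p : ℂ) ^ (-s) = 3 / 2 := by linear_combination (-3 / 2 : ℂ) * h
    rw [h'] at hx
    norm_num at hx

theorem norm_eulerFactorF_sub_one_le {p : ℕ} (hp : p.Prime) {s : ℂ} (hs : 0 < s.re) :
    ‖eulerFactorF p s - 1‖ ≤ 4 * (p : ℝ) ^ (-2 * s.re) := by
  have hx := hp.norm_cpow_neg_lt_one hs
  have hsq : ‖(p : ℂ) ^ (-s)‖ ^ 2 = (p : ℝ) ^ (-2 * s.re) := by
    rw [norm_natCast_cpow_of_pos hp.pos, neg_re, ← Real.rpow_mul_natCast p.cast_nonneg]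
    push_cast
    ring_nf
  rw [← hsq, eulerFactorF_eq_pow]
  set x := (p : ℂ) ^ (-s)
  have h0 := norm_nonneg x
  calc
    _ = ‖x ^ 2 * (-(5 / 3) + 10 / 27 * x + 20 / 27 * x ^ 2 - 8 / 27 * x ^ 3)‖ := by
      congr 1
      ring
    _ ≤ ‖x‖ ^ 2 * (5 / 3 + 10 / 27 * ‖x‖ + 20 / 27 * ‖x‖ ^ 2 + 8 / 27 * ‖x‖ ^ 3) := by
      rw [norm_mul, norm_pow]
      gcongr
      refine (norm_sub_le _ _).trans ?_
      gcongr
      · refine (norm_add₃_le).trans ?_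
        simp
      · simp
    _ ≤ ‖x‖ ^ 2 * 4 := by
      gcongr
      have h2 := pow_le_one₀ (n := 2) h0 hx.le
      have h3 := pow_le_one₀ (n := 3) h0 hx.le
      linarith
    _ = 4 * ‖x‖ ^ 2 := mul_comm _ _

theorem differentiable_eulerFactorF {p : ℕ} (hp : p ≠ 0) :
    Differentiable ℂ (eulerFactorF p) := by
  have hpow (c : ℂ) : Differentiable ℂ fun s : ℂ => (p : ℂ) ^ (c * s) :=
    (differentiable_id.const_mul c).const_cpow (Or.inl (Nat.cast_ne_zero.2 hp))
  unfold eulerFactorF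
  have := hpow (-2)
  have := hpow (-3)
  have := hpow (-4)
  have := hpow (-5)
  fun_prop

theorem summable_primes_rpow_neg_two_mul {σ : ℝ} (hσ : 1 / 2 < σ) :
    Summable fun p : Nat.Primes => 4 * ((p : ℕ) : ℝ) ^ (-2 * σ) :=
  (Nat.Primes.summable_rpow.2 (by linarith)).mul_left 4

theorem tprod_eulerFactorF_ne_zero {s : ℂ} (hs : 1 / 2 < s.re) :
    (∏' p : Nat.Primes, eulerFactorF (p : ℕ) s) ≠ 0 := by
  have hs0 : 0 < s.re := by linarith
  have h := tprod_one_add_ne_zero_of_summable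
    (f := fun p : Nat.Primes => eulerFactorF (p : ℕ) s - 1)
    (fun p => by simpa using eulerFactorF_ne_zero p.2 hs0)
    ((summable_primes_rpow_neg_two_mul hs).of_nonneg_of_le (fun _ => norm_nonneg _)
      fun p => norm_eulerFactorF_sub_one_le p.2 hs0)
  simpa using h

theorem differentiableOn_tprod_eulerFactorF_of_lt {σ : ℝ} (hσ : 1 / 2 < σ) :
    DifferentiableOn ℂ (fun s : ℂ => ∏' p : Nat.Primes, eulerFactorF (p : ℕ) s)
      {s : ℂ | σ < s.re} := by
  have hdiff (p : Nat.Primes) := differentiable_eulerFactorF p.2.ne_zero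
  have h := Summable.hasProdLocallyUniformlyOn_one_add
    (f := fun (p : Nat.Primes) s => eulerFactorF (p : ℕ) s - 1) (isOpen_re_gt σ)
    (summable_primes_rpow_neg_two_mul hσ)
    (Eventually.of_forall fun p s (hs : σ < s.re) =>
      (norm_eulerFactorF_sub_one_le p.2 (by linarith)).trans (by
        gcongr 4 * ?_
        exact Real.rpow_le_rpow_of_exponent_le (mod_cast p.2.one_le) (by linarith)))
    fun p => ((hdiff p).continuous.sub continuous_const).continuousOn
  simp only [add_sub_cancel] at h
  refine (hasProdLocallyUniformlyOn_iff_tendstoLocallyUniformlyOn.1 h).differentiableOn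
    (Eventually.of_forall fun t => ?_) (isOpen_re_gt σ)
  exact DifferentiableOn.fun_finsetProd fun p _ => (hdiff p).differentiableOn

theorem differentiableOn_tprod_eulerFactorF :
    DifferentiableOn ℂ (fun s : ℂ => ∏' p : Nat.Primes, eulerFactorF (p : ℕ) s)
      {s : ℂ | 1 / 2 < s.re} := by
  intro s hs
  obtain ⟨σ, hσ, hσs⟩ := exists_between (show 1 / 2 < s.re from hs)
  exact ((differentiableOn_tprod_eulerFactorF_of_lt hσ).differentiableAt
    ((isOpen_re_gt σ).mem_nhds hσs)).differentiableWithinAt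

/-- Factorization and non-vanishing of the Euler factors on `Re(s) > 1/2`, hence
non-vanishing of the product `F` and holomorphy of `F⁻¹` there. -/
theorem eulerFactorF_factorization_and_nonvanishing :
    (∀ p : ℕ, p.Prime → ∀ s : ℂ, 1 / 2 < s.re →
      (eulerFactorF p s
        = (1 + (p : ℂ) ^ (-s)) ^ 2 * (1 - (2 / 3 : ℂ) * (p : ℂ) ^ (-s)) ^ 3) ∧
      eulerFactorF p s ≠ 0) ∧
    (∀ s : ℂ, 1 / 2 < s.re → (∏' p : Nat.Primes, eulerFactorF (p : ℕ) s) ≠ 0) ∧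
    DifferentiableOn ℂ (fun s : ℂ => (∏' p : Nat.Primes, eulerFactorF (p : ℕ) s)⁻¹)
      {s : ℂ | 1 / 2 < s.re} :=
  ⟨fun p hp s hs => ⟨eulerFactorF_factorization p s, eulerFactorF_ne_zero hp (by linarith)⟩,
    fun _ hs => tprod_eulerFactorF_ne_zero hs,
    differentiableOn_tprod_eulerFactorF.fun_inv fun _ hs => tprod_eulerFactorF_ne_zero hs⟩
end
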